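/- arXiv:2310.05726 — 9 statements merged into one kernel-verified Lean document; each statement's English description precedes it below -/
import Mathlib

section
/- Fix integers d ≥ 2, n ≥ 1 and a real number α with −1 ≤ α ≤ 1. Let M_α be the matrix indexed by (Fin n → Fin d) × (Fin n → Fin d) with entries M_α ((f,g),(f',g')) = ∏_{m : Fin n} ((if f m = f' m then 1 else 0)·(if g m = g' m then 1 else 0) + α·(if f m = g m then 1 else 0)·(if f' m = g' m then 1 else 0)); this is the n-fold tensor power of the partial transpose of 1 + αF on ℂ^d ⊗ ℂ^d, where F is the flip operator. Then the following are equivalent: (i) there exist vectors v₁, v₂, w₁, w₂ : (Fin n → Fin d) → ℂ such that, setting ψ(f,g) = v₁ f · w₁ g + v₂ f · w₂ g, the (real) quadratic form ∑_{p,q} conj(ψ p) · M_α p q · ψ q is negative; (ii) there exists a matrix C : Matrix (Fin n → Fin d) (Fin n → Fin d) ℂ with rank C ≤ 2 and q^(n)(α,C) < 0. (Equivalently: the d-dimensional Werner state ρ_α is n-distillable if and only if some rank ≤ 2 matrix C has q^(n)(α,C) < 0.) -/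
open Finset

/-- Squared Frobenius (Hilbert–Schmidt) norm of a complex matrix. -/
noncomputable def frobSq {m n : Type*} [Fintype m] [Fintype n] (M : Matrix m n ℂ) : ℝ :=
  ∑ p, ∑ q, ‖M p q‖ ^ 2

/-- Merge an assignment on a finset `J` with an assignment on its complement. -/
def mergeFun {n : ℕ} {d : Fin n → ℕ} (J : Finset (Fin n))
    (h : (i : {i : Fin n // i ∈ J}) → Fin (d i.1))
    (f : (i : {i : Fin n // i ∉ J}) → Fin (d i.1)) :
    (i : Fin n) → Fin (d i) :=
  fun i => if hi : i ∈ J then h ⟨i, hi⟩ else f ⟨i, hi⟩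

/-- Partial trace of a matrix on an `n`-partite system over the subsystems in `J`. -/
noncomputable def ptrace {n : ℕ} {d : Fin n → ℕ} (J : Finset (Fin n))
    (C : Matrix ((i : Fin n) → Fin (d i)) ((i : Fin n) → Fin (d i)) ℂ) :
    Matrix ((i : {i : Fin n // i ∉ J}) → Fin (d i.1))
      ((i : {i : Fin n // i ∉ J}) → Fin (d i.1)) ℂ :=
  Matrix.of fun f g =>
    ∑ h : (i : {i : Fin n // i ∈ J}) → Fin (d i.1), C (mergeFun J h f) (mergeFun J h g)

/-- The quadratic form `q^(n)(α, C) = ∑_J α^{|J|} ‖tr_J C‖₂²`. -/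
noncomputable def qForm {n : ℕ} {d : Fin n → ℕ} (α : ℝ)
    (C : Matrix ((i : Fin n) → Fin (d i)) ((i : Fin n) → Fin (d i)) ℂ) : ℝ :=
  ∑ J : Finset (Fin n), α ^ J.card * frobSq (ptrace J C)

/-- The `n`-fold tensor power of the partial transpose of `1 + αF` on `ℂ^d ⊗ ℂ^d`. -/
noncomputable def wernerPT (n d : ℕ) (α : ℝ) :
    Matrix ((Fin n → Fin d) × (Fin n → Fin d)) ((Fin n → Fin d) × (Fin n → Fin d)) ℂ :=
  Matrix.of fun p q => ∏ m : Fin n,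
    ((if p.1 m = q.1 m then (1 : ℂ) else 0) * (if p.2 m = q.2 m then (1 : ℂ) else 0)
      + (α : ℂ) * (if p.1 m = p.2 m then (1 : ℂ) else 0)
        * (if q.1 m = q.2 m then (1 : ℂ) else 0))

/-- A matrix has rank at most `k` iff it factors through a `k`-dimensional space. -/
theorem rank_le_iff_exists_eq_mul {K m n : Type*} [Field K] [Fintype m] [Fintype n]
    (C : Matrix m n K) (k : ℕ) :
    C.rank ≤ k ↔ ∃ (A : Matrix m (Fin k) K) (B : Matrix (Fin k) n K), C = A * B := by
  classical
  constructor
  · intro hC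
    have hle : Module.finrank K (LinearMap.range C.mulVecLin) ≤
        Module.finrank K (Fin k → K) := by
      rwa [Module.finrank_fin_fun]
    obtain ⟨φ, hφ⟩ := finrank_le_iff_exists_linearMap.mp hle
    obtain ⟨r, hr⟩ := φ.exists_leftInverse_of_injective (LinearMap.ker_eq_bot.mpr hφ)
    refine ⟨LinearMap.toMatrix' ((LinearMap.range C.mulVecLin).subtype ∘ₗ r),
      LinearMap.toMatrix' (φ ∘ₗ C.mulVecLin.rangeRestrict), ?_⟩
    rw [← LinearMap.toMatrix'_comp, LinearMap.comp_assoc, ← LinearMap.comp_assoc _ φ r, hr,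
      LinearMap.id_comp, LinearMap.subtype_comp_codRestrict, ← Matrix.toLin'_apply',
      LinearMap.toMatrix'_toLin']
  · rintro ⟨A, B, rfl⟩
    exact (Matrix.rank_mul_le_left A B).trans (by simpa using A.rank_le_card_width)

/-- The squared Frobenius norm of a partial trace as a sum over the entries of the matrix. -/
theorem frobSq_ptrace {n : ℕ} {d : Fin n → ℕ} (J : Finset (Fin n))
    (C : Matrix ((i : Fin n) → Fin (d i)) ((i : Fin n) → Fin (d i)) ℂ) :
    (frobSq (ptrace J C) : ℂ) = ∑ f, ∑ g, ∑ h, ∑ h',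
      (starRingEnd ℂ) (C (mergeFun J h f) (mergeFun J h g)) *
        C (mergeFun J h' f) (mergeFun J h' g) := by
  simp only [frobSq, ptrace, Matrix.of_apply, Complex.ofReal_sum, Complex.ofReal_pow,
    ← Complex.conj_mul', map_sum, sum_mul_sum]

/-- Summing over global assignments is summing over pairs of an assignment on `J` and one on its
complement. -/
theorem sum_eq_sum_mergeFun {M : Type*} [AddCommMonoid M] {n : ℕ} {d : Fin n → ℕ}
    (J : Finset (Fin n)) (F : ((i : Fin n) → Fin (d i)) → M) :
    ∑ f, F f = ∑ h, ∑ f, F (mergeFun J h f) := by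
  rw [← Fintype.sum_prod_type']
  exact ((Equiv.piEquivPiSubtypeProd (· ∈ J) fun i => Fin (d i)).symm.sum_comp F).symm

theorem prod_mem_eq_mergeFun {R : Type*} [CommSemiring R] {n : ℕ} {d : Fin n → ℕ}
    (J : Finset (Fin n)) (h h' : (i : {i : Fin n // i ∈ J}) → Fin (d i.1))
    (f f' : (i : {i : Fin n // i ∉ J}) → Fin (d i.1)) :
    (∏ i ∈ J, if mergeFun J h f i = mergeFun J h' f' i then (1 : R) else 0) =
      if h = h' then 1 else 0 := by
  rw [prod_boole]
  congr 1
  simp +contextual [funext_iff, mergeFun]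

theorem prod_compl_eq_mergeFun {R : Type*} [CommSemiring R] {n : ℕ} {d : Fin n → ℕ}
    (J : Finset (Fin n)) (h h' : (i : {i : Fin n // i ∈ J}) → Fin (d i.1))
    (f f' : (i : {i : Fin n // i ∉ J}) → Fin (d i.1)) :
    (∏ i ∈ univ \ J, if mergeFun J h f i = mergeFun J h' f' i then (1 : R) else 0) =
      if f = f' then 1 else 0 := by
  rw [prod_boole]
  congr 1
  simp +contextual [funext_iff, mergeFun]

/-- Expansion of the tensor power `wernerPT` over the set of factors carrying `α`. -/
theorem wernerPT_apply (n d : ℕ) (α : ℝ) (f g f' g' : Fin n → Fin d) :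
    wernerPT n d α (f, g) (f', g') = ∑ J : Finset (Fin n), (α : ℂ) ^ J.card *
      ((∏ i ∈ J, if f i = g i then (1 : ℂ) else 0) *
        (∏ i ∈ J, if f' i = g' i then (1 : ℂ) else 0) *
        (∏ i ∈ univ \ J, if f i = f' i then (1 : ℂ) else 0) *
        ∏ i ∈ univ \ J, if g i = g' i then (1 : ℂ) else 0) := by
  simp only [wernerPT, Matrix.of_apply]
  rw [prod_congr rfl fun i _ => add_comm _ _, prod_add, powerset_univ]
  refine sum_congr rfl fun J _ => ?_
  simp only [prod_mul_distrib, prod_const]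
  ring

/-- The quadratic form of `wernerPT` at the vectorization of `C` is `qForm α C`. -/
theorem sum_wernerPT_eq_qForm (n d : ℕ) (α : ℝ)
    (C : Matrix (Fin n → Fin d) (Fin n → Fin d) ℂ) :
    ∑ p : (Fin n → Fin d) × (Fin n → Fin d), ∑ q : (Fin n → Fin d) × (Fin n → Fin d),
      (starRingEnd ℂ) (C p.1 p.2) * wernerPT n d α p q * C q.1 q.2 =
      (qForm (d := fun _ => d) α C : ℂ) := by
  simp only [Fintype.sum_prod_type, wernerPT_apply, mul_sum, sum_mul, qForm, Complex.ofReal_sum,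
    Complex.ofReal_mul, Complex.ofReal_pow, frobSq_ptrace]
  simp_rw [sum_comm (t := (univ : Finset (Finset (Fin n))))]
  refine sum_congr rfl fun J _ => ?_
  simp_rw [sum_eq_sum_mergeFun (d := fun _ => d) J, prod_mem_eq_mergeFun (d := fun _ => d),
    prod_compl_eq_mergeFun (d := fun _ => d)]
  simp only [mul_ite, mul_one, mul_zero, ite_mul, zero_mul, sum_ite_eq, mem_univ, ↓reduceIte,
    sum_ite_irrel, sum_const_zero]
  rw [sum_comm]
  refine sum_congr rfl fun f _ => ?_
  rw [sum_comm]
  refine sum_congr rfl fun g _ => sum_congr rfl fun h _ => sum_congr rfl fun h' _ => ?_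
  ring

/-- The Werner state `ρ_α` on `ℂ^d ⊗ ℂ^d` is `n`-distillable (i.e. its partial transpose
fails positivity on some Schmidt-rank-≤2 vector) iff some matrix `C` of rank at most `2`
has `q^(n)(α, C) < 0`. -/
theorem werner_n_distillable_iff_qForm_neg (d n : ℕ) (hd : 2 ≤ d) (hn : 1 ≤ n)
    (α : ℝ) (hα₁ : -1 ≤ α) (hα₂ : α ≤ 1) :
    (∃ v₁ v₂ w₁ w₂ : (Fin n → Fin d) → ℂ,
      ∃ ψ : (Fin n → Fin d) × (Fin n → Fin d) → ℂ,
        (∀ r, ψ r = v₁ r.1 * w₁ r.2 + v₂ r.1 * w₂ r.2) ∧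
        (∑ p, ∑ q, (starRingEnd ℂ) (ψ p) * wernerPT n d α p q * ψ q).re < 0)
    ↔ ∃ C : Matrix (Fin n → Fin d) (Fin n → Fin d) ℂ,
        C.rank ≤ 2 ∧ qForm (d := fun _ => d) α C < 0 := by
  constructor
  · rintro ⟨v₁, v₂, w₁, w₂, ψ, hψ, hneg⟩
    refine ⟨Matrix.of fun f g => ψ (f, g), ?_, ?_⟩
    · refine (rank_le_iff_exists_eq_mul _ 2).mpr
        ⟨Matrix.of fun f => ![v₁ f, v₂ f], Matrix.of ![w₁, w₂], ?_⟩
      ext f g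
      simp [Matrix.mul_apply, hψ]
    · rw [← Complex.ofReal_re (qForm _ _), ← sum_wernerPT_eq_qForm]
      exact hneg
  · rintro ⟨C, hC, hneg⟩
    obtain ⟨A, B, rfl⟩ := (rank_le_iff_exists_eq_mul C 2).mp hC
    refine ⟨fun f => A f 0, fun f => A f 1, B 0, B 1, fun p => (A * B) p.1 p.2, fun p => ?_, ?_⟩
    · simp [Matrix.mul_apply]
    · rwa [sum_wernerPT_eq_qForm, Complex.ofReal_re]
end

section
/- Let d₁, d₂ ≥ 1 and let C : Matrix (Fin d₁ × Fin d₂) (Fin d₁ × Fin d₂) ℂ be a nonzero matrix of rank r. Then for every real number α with α ≥ −1/(2r), one has ‖C‖₂² + α·(‖tr₁ C‖₂² + ‖tr₂ C‖₂²) + α²·|tr C|² ≥ 0. (Consequently, the Werner state ρ_α is 2-undistillable for α ≥ −1/4.) -/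
open Finset

/-- Partial trace over the first tensor factor. -/
noncomputable def ptr1 {d₁ d₂ : ℕ} (C : Matrix (Fin d₁ × Fin d₂) (Fin d₁ × Fin d₂) ℂ) :
    Matrix (Fin d₂) (Fin d₂) ℂ :=
  Matrix.of fun j j' => ∑ i, C (i, j) (i, j')

/-- Partial trace over the second tensor factor. -/
noncomputable def ptr2 {d₁ d₂ : ℕ} (C : Matrix (Fin d₁ × Fin d₂) (Fin d₁ × Fin d₂) ℂ) :
    Matrix (Fin d₁) (Fin d₁) ℂ :=
  Matrix.of fun i i' => ∑ j, C (i, j) (i', j)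

/-- A complex matrix of rank `r` is a sum of `r` rank-one matrices whose left factors have norm one,
and whose right factors carry the whole Frobenius norm. -/
theorem exists_rank_factorization {m n : Type*} [Fintype m] [Fintype n] (C : Matrix m n ℂ) :
    ∃ (u : Fin C.rank → m → ℂ) (w : Fin C.rank → n → ℂ),
      (∀ p q, C p q = ∑ k, u k p * w k q) ∧ (∀ k, ∑ p, ‖u k p‖ ^ 2 = 1) ∧
      ∑ k, ∑ q, ‖w k q‖ ^ 2 = frobSq C := by
  let e := (WithLp.linearEquiv 2 ℂ (m → ℂ)).symm
  let S : Submodule ℂ (EuclideanSpace ℂ m) :=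
    (Submodule.span ℂ (Set.range C.col)).map (e : (m → ℂ) →ₗ[ℂ] EuclideanSpace ℂ m)
  have hS : Module.finrank ℂ S = C.rank := by
    rw [C.rank_eq_finrank_span_cols]
    exact LinearEquiv.finrank_map_eq e _
  let b : OrthonormalBasis (Fin C.rank) ℂ S :=
    (stdOrthonormalBasis ℂ S).reindex (finCongr hS)
  let c : n → S := fun q =>
    ⟨e (C.col q), Submodule.mem_map_of_mem (Submodule.subset_span ⟨q, rfl⟩)⟩
  have hc : ∀ p q, (c q : EuclideanSpace ℂ m) p = C p q := fun _ _ => rfl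
  refine ⟨fun k p => (b k : EuclideanSpace ℂ m) p, fun k q => inner ℂ (b k) (c q), ?_, ?_, ?_⟩
  · intro p q
    have h := congrArg (fun x : S => (x : EuclideanSpace ℂ m) p) (b.sum_repr' (c q))
    simp only [Submodule.coe_sum, Submodule.coe_smul, WithLp.ofLp_sum, WithLp.ofLp_smul,
      Finset.sum_apply, Pi.smul_apply, smul_eq_mul] at h
    rw [← hc p q, ← h]
    exact Finset.sum_congr rfl fun k _ => mul_comm _ _
  · intro k
    rw [← EuclideanSpace.norm_sq_eq, ← Submodule.coe_norm, b.orthonormal.1 k, one_pow]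
  · rw [Finset.sum_comm, frobSq, Finset.sum_comm (s := (univ : Finset m))]
    refine Finset.sum_congr rfl fun q _ => ?_
    rw [b.sum_sq_norm_inner_right, Submodule.coe_norm, EuclideanSpace.norm_sq_eq]
    rfl

/-- The squared Frobenius norm of a partial trace of `C` is at most `C.rank` times that of `C`. -/
theorem sum_sq_norm_partialTrace_le {ι κ : Type*} [Fintype ι] [Fintype κ]
    (C : Matrix (ι × κ) (ι × κ) ℂ) :
    ∑ j, ∑ j', ‖∑ i, C (i, j) (i, j')‖ ^ 2 ≤ C.rank * frobSq C := by
  obtain ⟨u, w, hC, hu, hw⟩ := exists_rank_factorization C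
  have key : ∀ j j', ‖∑ i, C (i, j) (i, j')‖ ^ 2 ≤
      C.rank * ∑ k, (∑ i, ‖u k (i, j)‖ ^ 2) * ∑ i, ‖w k (i, j')‖ ^ 2 := by
    intro j j'
    calc ‖∑ i, C (i, j) (i, j')‖ ^ 2
        ≤ (∑ k, ∑ i, ‖u k (i, j)‖ * ‖w k (i, j')‖) ^ 2 := by
          gcongr
          simp_rw [hC]
          rw [Finset.sum_comm]
          refine norm_sum_le_of_le _ fun k _ => norm_sum_le_of_le _ fun i _ => ?_
          exact (norm_mul _ _).le
      _ ≤ C.rank * ∑ k, (∑ i, ‖u k (i, j)‖ * ‖w k (i, j')‖) ^ 2 := by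
          simpa using sq_sum_le_card_mul_sum_sq (s := (univ : Finset (Fin C.rank)))
            (f := fun k => ∑ i, ‖u k (i, j)‖ * ‖w k (i, j')‖)
      _ ≤ _ := by
          gcongr with k
          exact Finset.sum_mul_sq_le_sq_mul_sq _ _ _
  calc ∑ j, ∑ j', ‖∑ i, C (i, j) (i, j')‖ ^ 2
      ≤ ∑ j, ∑ j', C.rank * ∑ k, (∑ i, ‖u k (i, j)‖ ^ 2) * ∑ i, ‖w k (i, j')‖ ^ 2 := by
        gcongr with j _ j' _
        exact key j j'
    _ = C.rank * ∑ k, (∑ p, ‖u k p‖ ^ 2) * ∑ q, ‖w k q‖ ^ 2 := by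
        simp_rw [← Finset.mul_sum]
        congr 1
        simp_rw [Finset.sum_comm (t := (univ : Finset (Fin C.rank)))]
        refine Finset.sum_congr rfl fun k _ => ?_
        rw [← Finset.sum_mul_sum, Fintype.sum_prod_type_right, Fintype.sum_prod_type_right]
    _ = C.rank * frobSq C := by simp_rw [hu, one_mul, hw]

theorem frobSq_ptr1_le {d₁ d₂ : ℕ} (C : Matrix (Fin d₁ × Fin d₂) (Fin d₁ × Fin d₂) ℂ) :
    frobSq (ptr1 C) ≤ C.rank * frobSq C :=
  sum_sq_norm_partialTrace_le C

theorem frobSq_ptr2_le {d₁ d₂ : ℕ} (C : Matrix (Fin d₁ × Fin d₂) (Fin d₁ × Fin d₂) ℂ) :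
    frobSq (ptr2 C) ≤ C.rank * frobSq C := by
  let s := Equiv.prodComm (Fin d₂) (Fin d₁)
  have h := sum_sq_norm_partialTrace_le (C.submatrix s s)
  have hs : frobSq (C.submatrix s s) = frobSq C := by
    simp only [frobSq, Matrix.submatrix_apply]
    rw [s.sum_comp fun p => ∑ q, ‖C p (s q)‖ ^ 2]
    exact Finset.sum_congr rfl fun p _ => s.sum_comp fun q => ‖C p q‖ ^ 2
  rw [Matrix.rank_submatrix, hs] at h
  exact h

theorem frobSq_nonneg {m n : Type*} [Fintype m] [Fintype n] (M : Matrix m n ℂ) : 0 ≤ frobSq M := by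
  unfold frobSq
  positivity

/-- For a nonzero matrix `C` of rank `r` and `α ≥ -1/(2r)`, the bipartite quadratic form
`q^(2)(α, C) = ‖C‖₂² + α(‖tr₁C‖₂² + ‖tr₂C‖₂²) + α²|tr C|²` is nonnegative. -/
theorem q2_nonneg_of_ge_neg_inv_two_rank (d₁ d₂ : ℕ) (hd₁ : 1 ≤ d₁) (hd₂ : 1 ≤ d₂)
    (C : Matrix (Fin d₁ × Fin d₂) (Fin d₁ × Fin d₂) ℂ) (hC : C ≠ 0)
    (α : ℝ) (hα : -(1 / (2 * (C.rank : ℝ))) ≤ α) :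
    0 ≤ frobSq C + α * (frobSq (ptr1 C) + frobSq (ptr2 C)) + α ^ 2 * ‖C.trace‖ ^ 2 := by
  have h0 := frobSq_nonneg C
  have h1 := frobSq_ptr1_le C
  have h2 := frobSq_ptr2_le C
  have hT : 0 ≤ frobSq (ptr1 C) + frobSq (ptr2 C) :=
    add_nonneg (frobSq_nonneg _) (frobSq_nonneg _)
  have hr : 0 ≤ 1 / (2 * (C.rank : ℝ)) := by positivity
  have hbound : 1 / (2 * (C.rank : ℝ)) * (frobSq (ptr1 C) + frobSq (ptr2 C)) ≤ frobSq C := by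
    rw [one_div_mul_eq_div]
    exact div_le_of_le_mul₀ (by positivity) h0 (by linarith)
  have hmul := mul_le_mul_of_nonneg_right hα hT
  have hsq : 0 ≤ α ^ 2 * ‖C.trace‖ ^ 2 := by positivity
  linarith
end

section
/- Let d₁, d₂ ≥ 1 and let v, w : Fin d₁ × Fin d₂ → ℂ. Then the rank-one matrix C = v wᴴ, i.e. C p q = v p · conj(w q), satisfies ‖tr₁ C‖₂² + ‖tr₂ C‖₂² ≤ ‖C‖₂² + |tr C|². (This says q^(2)(−1, C) ≥ 0 for every rank-one bipartite matrix C.) -/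
open Finset

lemma ofReal_frobSq {m n : Type*} [Fintype m] [Fintype n] (M : Matrix m n ℂ) :
    ((frobSq M : ℝ) : ℂ) = ∑ p, ∑ q, M p q * (starRingEnd ℂ) (M p q) := by
  simp [frobSq, Complex.mul_conj']

lemma sum_pair_comm {α β : Type*} [Fintype α] [Fintype β] (f : α → α → β → β → ℂ) :
    ∑ i, ∑ k, ∑ j, ∑ l, f i k j l = ∑ j, ∑ l, ∑ i, ∑ k, f i k j l := by
  have h := Finset.sum_comm (s := (Finset.univ : Finset (α × α)))
    (t := (Finset.univ : Finset (β × β))) (f := fun x y => f x.1 x.2 y.1 y.2)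
  simpa only [Fintype.sum_prod_type] using h

/-- The antisymmetrization of `V ⊗ W` in the row indices and in the column indices. -/
def doubleAntisymm {α β : Type*} (V W : α → β → ℂ) (i k : α) (j l : β) : ℂ :=
  V i j * W k l - V k j * W i l - V i l * W k j + V k l * W i j

lemma sum_doubleAntisymm_mul_conj {α β : Type*} [Fintype α] [Fintype β] (V W : α → β → ℂ) :
    ∑ i, ∑ k, ∑ j, ∑ l, doubleAntisymm V W i k j l *
        (starRingEnd ℂ) (doubleAntisymm V W i k j l) =
      4 * ∑ i, ∑ k, ∑ j, ∑ l, doubleAntisymm V W i k j l * (starRingEnd ℂ) (V i j * W k l) := by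
  set P := doubleAntisymm V W with hP
  have row_swap : ∀ f : α → α → β → β → ℂ, ∑ i, ∑ k, ∑ j, ∑ l, P i k j l * f k i j l =
      -∑ i, ∑ k, ∑ j, ∑ l, P i k j l * f i k j l := by
    intro f
    rw [Finset.sum_comm]
    simp only [← Finset.sum_neg_distrib]
    refine Fintype.sum_congr _ _ fun i => Fintype.sum_congr _ _ fun k =>
      Fintype.sum_congr _ _ fun j => Fintype.sum_congr _ _ fun l => ?_
    simp only [hP, doubleAntisymm]
    ring
  have col_swap : ∀ f : α → α → β → β → ℂ, ∑ i, ∑ k, ∑ j, ∑ l, P i k j l * f i k l j =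
      -∑ i, ∑ k, ∑ j, ∑ l, P i k j l * f i k j l := by
    intro f
    simp only [← Finset.sum_neg_distrib]
    refine Fintype.sum_congr _ _ fun i => Fintype.sum_congr _ _ fun k => ?_
    rw [Finset.sum_comm]
    refine Fintype.sum_congr _ _ fun j => Fintype.sum_congr _ _ fun l => ?_
    simp only [hP, doubleAntisymm]
    ring
  let T : α → α → β → β → ℂ := fun i k j l => (starRingEnd ℂ) (V i j * W k l)
  have hrow := row_swap T
  have hcol := col_swap T
  have hboth := row_swap fun i k j l => T i k l j
  rw [hcol, neg_neg] at hboth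
  have expand : ∀ i k j l, P i k j l * (starRingEnd ℂ) (P i k j l) =
      P i k j l * T i k j l - P i k j l * T k i j l - P i k j l * T i k l j +
        P i k j l * T k i l j := by
    intro i k j l
    simp only [hP, doubleAntisymm, T, map_add, map_sub]
    ring
  simp only [expand, Finset.sum_add_distrib, Finset.sum_sub_distrib, hrow, hcol, hboth]
  ring

/-- For a rank-one bipartite matrix `C = v wᴴ`,
`‖tr₁ C‖₂² + ‖tr₂ C‖₂² ≤ ‖C‖₂² + |tr C|²`, i.e. `q^(2)(-1, C) ≥ 0`. -/
theorem rank_one_q2_neg_one_nonneg (d₁ d₂ : ℕ) (hd₁ : 1 ≤ d₁) (hd₂ : 1 ≤ d₂)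
    (v w : Fin d₁ × Fin d₂ → ℂ)
    (C : Matrix (Fin d₁ × Fin d₂) (Fin d₁ × Fin d₂) ℂ)
    (hC : C = Matrix.of fun p q => v p * (starRingEnd ℂ) (w q)) :
    frobSq (ptr1 C) + frobSq (ptr2 C) ≤ frobSq C + ‖C.trace‖ ^ 2 := by
  let V : Fin d₁ → Fin d₂ → ℂ := fun i j => v (i, j)
  let W : Fin d₁ → Fin d₂ → ℂ := fun i j => w (i, j)
  have h1 : ((frobSq (ptr1 C) : ℝ) : ℂ) =
      ∑ i, ∑ k, ∑ j, ∑ l, V k j * W i l * (starRingEnd ℂ) (V i j * W k l) := by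
    rw [ofReal_frobSq, sum_pair_comm]
    refine Fintype.sum_congr _ _ fun j => Fintype.sum_congr _ _ fun l => ?_
    rw [Finset.sum_comm]
    simp only [hC, ptr1, Matrix.of_apply, map_sum, map_mul, Complex.conj_conj,
      Finset.sum_mul_sum, V, W]
    refine Fintype.sum_congr _ _ fun i => Fintype.sum_congr _ _ fun k => ?_
    ring
  have h2 : ((frobSq (ptr2 C) : ℝ) : ℂ) =
      ∑ i, ∑ k, ∑ j, ∑ l, V i l * W k j * (starRingEnd ℂ) (V i j * W k l) := by
    rw [ofReal_frobSq]
    refine Fintype.sum_congr _ _ fun i => Fintype.sum_congr _ _ fun k => ?_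
    rw [Finset.sum_comm]
    simp only [hC, ptr2, Matrix.of_apply, map_sum, map_mul, Complex.conj_conj,
      Finset.sum_mul_sum, V, W]
    refine Fintype.sum_congr _ _ fun j => Fintype.sum_congr _ _ fun l => ?_
    ring
  have h3 : ((frobSq C : ℝ) : ℂ) =
      ∑ i, ∑ k, ∑ j, ∑ l, V i j * W k l * (starRingEnd ℂ) (V i j * W k l) := by
    rw [ofReal_frobSq]
    simp only [hC, Matrix.of_apply, map_mul, Complex.conj_conj, Fintype.sum_prod_type, V, W]
    refine Fintype.sum_congr _ _ fun i => ?_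
    rw [Finset.sum_comm]
    refine Fintype.sum_congr _ _ fun k => Fintype.sum_congr _ _ fun j =>
      Fintype.sum_congr _ _ fun l => ?_
    ring
  have h4 : ((‖C.trace‖ ^ 2 : ℝ) : ℂ) =
      ∑ i, ∑ k, ∑ j, ∑ l, V k l * W i j * (starRingEnd ℂ) (V i j * W k l) := by
    rw [Complex.ofReal_pow, ← Complex.mul_conj']
    simp only [hC, Matrix.trace, Matrix.diag_apply, Matrix.of_apply, map_sum, map_mul,
      Complex.conj_conj, Fintype.sum_prod_type, Finset.sum_mul_sum, V, W]
    rw [Finset.sum_comm]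
    refine Fintype.sum_congr _ _ fun i => Fintype.sum_congr _ _ fun k => ?_
    rw [Finset.sum_comm]
    refine Fintype.sum_congr _ _ fun j => Fintype.sum_congr _ _ fun l => ?_
    ring
  have key : ∑ i, ∑ k, ∑ j, ∑ l, ‖doubleAntisymm V W i k j l‖ ^ 2 =
      4 * (frobSq C - frobSq (ptr1 C) - frobSq (ptr2 C) + ‖C.trace‖ ^ 2) := by
    apply Complex.ofReal_injective
    have h := sum_doubleAntisymm_mul_conj V W
    simp only [Complex.mul_conj'] at h
    rw [Complex.ofReal_mul, Complex.ofReal_add, Complex.ofReal_sub, Complex.ofReal_sub,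
      h1, h2, h3, h4]
    push_cast
    rw [h]
    simp only [doubleAntisymm, add_mul, sub_mul, Finset.sum_add_distrib,
      Finset.sum_sub_distrib]
  have nonneg : 0 ≤ ∑ i, ∑ k, ∑ j, ∑ l, ‖doubleAntisymm V W i k j l‖ ^ 2 := by positivity
  linarith
end

section
/- Let n ≥ 1 and d : Fin n → ℕ with d i ≥ 1 for every i, and let v, w : ((i : Fin n) → Fin (d i)) → ℂ. Then the rank-one matrix C = v wᴴ, i.e. C f g = v f · conj(w g), satisfies ∑_{J ⊆ Fin n} (−1)^{|J|} ‖tr_J C‖₂² ≥ 0. (This says q^(n)(−1, C) ≥ 0 for every rank-one matrix C on an n-partite system.) -/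
open Finset

/-- Exchange the coordinates in `J` between the two components of a pair of assignments. -/
def swapOn {ι : Type*} [DecidableEq ι] {β : ι → Type*} (J : Finset ι)
    (x : (∀ i, β i) × (∀ i, β i)) : (∀ i, β i) × (∀ i, β i) :=
  (J.piecewise x.2 x.1, J.piecewise x.1 x.2)

theorem swapOn_swapOn {ι : Type*} [DecidableEq ι] {β : ι → Type*} (J K : Finset ι)
    (x : (∀ i, β i) × (∀ i, β i)) : swapOn K (swapOn J x) = swapOn (symmDiff J K) x := by
  ext i <;> by_cases hJ : i ∈ J <;> by_cases hK : i ∈ K <;>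
    simp [swapOn, Finset.piecewise, Finset.mem_symmDiff, hJ, hK]

theorem swapOn_involutive {ι : Type*} [DecidableEq ι] {β : ι → Type*} (J : Finset ι) :
    Function.Involutive (swapOn (β := β) J) := by
  intro x
  rw [swapOn_swapOn, symmDiff_self]
  simp [swapOn]

theorem neg_one_pow_card_symmDiff {ι R : Type*} [DecidableEq ι] [CommRing R] (J K : Finset ι) :
    (-1 : R) ^ (symmDiff J K).card = (-1) ^ J.card * (-1) ^ K.card := by
  have hJ := Finset.card_sdiff_add_card_inter J K
  have hK := Finset.card_sdiff_add_card_inter K J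
  have hd : (symmDiff J K).card = (J \ K).card + (K \ J).card :=
    Finset.card_union_of_disjoint disjoint_sdiff_sdiff
  rw [Finset.inter_comm] at hK
  rw [hd, ← hJ, ← hK, ← pow_add]
  have : (J \ K).card + (J ∩ K).card + ((K \ J).card + (J ∩ K).card)
      = (J \ K).card + (K \ J).card + 2 * (J ∩ K).card := by ring
  rw [this, pow_add _ _ (2 * _), pow_mul, pow_add]
  simp

/-- The alternating sum of the coordinate-exchange operators is `2 ^ n` times a projection. -/
theorem sum_norm_sq_alternating_swapOn {ι : Type*} [Fintype ι] [DecidableEq ι] {β : ι → Type*}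
    [∀ i, Fintype (β i)] (X : (∀ i, β i) × (∀ i, β i) → ℂ) :
    ((∑ x, ‖∑ J : Finset ι, (-1 : ℂ) ^ J.card * X (swapOn J x)‖ ^ 2 : ℝ) : ℂ) =
      2 ^ Fintype.card ι * ∑ J : Finset ι, (-1 : ℂ) ^ J.card *
        ∑ x, X x * (starRingEnd ℂ) (X (swapOn J x)) := by
  have key : ∀ J : Finset ι, ∑ K : Finset ι, (-1 : ℂ) ^ J.card * (-1) ^ K.card *
      ∑ x, X (swapOn J x) * (starRingEnd ℂ) (X (swapOn K x)) =
      ∑ K : Finset ι, (-1 : ℂ) ^ K.card * ∑ x, X x * (starRingEnd ℂ) (X (swapOn K x)) := by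
    intro J
    refine Fintype.sum_equiv (symmDiff_right_involutive J).toPerm _ _ fun K => ?_
    simp only [Function.Involutive.coe_toPerm]
    rw [neg_one_pow_card_symmDiff]
    congr 1
    refine Fintype.sum_equiv (swapOn_involutive J).toPerm _ _ fun x => ?_
    simp only [Function.Involutive.coe_toPerm]
    rw [swapOn_swapOn, symmDiff_symmDiff_cancel_left]
  calc _ = ∑ J : Finset ι, ∑ K : Finset ι, (-1 : ℂ) ^ J.card * (-1) ^ K.card *
        ∑ x, X (swapOn J x) * (starRingEnd ℂ) (X (swapOn K x)) := by
        push_cast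
        simp only [← Complex.mul_conj', map_sum, map_mul, map_pow, map_neg, map_one,
          Finset.sum_mul_sum]
        rw [Finset.sum_comm]
        refine Finset.sum_congr rfl fun J _ => ?_
        rw [Finset.sum_comm]
        refine Finset.sum_congr rfl fun K _ => ?_
        rw [Finset.mul_sum]
        refine Finset.sum_congr rfl fun x _ => ?_
        ring
    _ = _ := by
        simp only [key]
        simp

/-- For a rank-one matrix, `‖tr_J C‖₂²` is an expectation of the exchange operator on `J`. -/
theorem frobSq_ptrace_rank_one {n : ℕ} {d : Fin n → ℕ} (J : Finset (Fin n))
    (v w : ((i : Fin n) → Fin (d i)) → ℂ) :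
    (frobSq (ptrace J (Matrix.of fun f g => v f * (starRingEnd ℂ) (w g))) : ℂ) =
      ∑ x : ((i : Fin n) → Fin (d i)) × ((i : Fin n) → Fin (d i)),
        v x.1 * w x.2 * (starRingEnd ℂ) (v (swapOn J x).1 * w (swapOn J x).2) := by
  let e := (Equiv.piEquivPiSubtypeProd (fun i => i ∈ J) (fun i => Fin (d i))).symm
  have he : ∀ p, e p = mergeFun J p.1 p.2 := fun _ => rfl
  have hp : ∀ h h' f f', J.piecewise (mergeFun (d := d) J h' f') (mergeFun J h f) =
      mergeFun J h' f := by
    intro h h' f f'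
    ext i
    by_cases hi : i ∈ J <;> simp [mergeFun, hi]
  rw [← (e.prodCongr e).sum_comp]
  simp only [Fintype.sum_prod_type, Equiv.prodCongr_apply, Prod.map, he, swapOn, hp]
  simp only [frobSq, ptrace, Matrix.of_apply]
  push_cast
  simp only [← Complex.mul_conj', map_sum, map_mul, Complex.conj_conj, Finset.sum_mul_sum]
  conv_rhs => rw [Finset.sum_comm]
  refine Finset.sum_congr rfl fun f _ => ?_
  rw [Finset.sum_comm]
  refine Finset.sum_congr rfl fun h _ => ?_
  rw [Finset.sum_comm]
  refine Finset.sum_congr rfl fun h' _ => Finset.sum_congr rfl fun g _ => ?_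
  ring

/-- For a rank-one matrix `C = v wᴴ` on an `n`-partite system,
`q^(n)(-1, C) = ∑_J (-1)^{|J|} ‖tr_J C‖₂² ≥ 0`. -/
theorem rank_one_qn_neg_one_nonneg (n : ℕ) (hn : 1 ≤ n) (d : Fin n → ℕ) (hd : ∀ i, 1 ≤ d i)
    (v w : ((i : Fin n) → Fin (d i)) → ℂ)
    (C : Matrix ((i : Fin n) → Fin (d i)) ((i : Fin n) → Fin (d i)) ℂ)
    (hC : C = Matrix.of fun f g => v f * (starRingEnd ℂ) (w g)) :
    0 ≤ ∑ J : Finset (Fin n), (-1 : ℝ) ^ J.card * frobSq (ptrace J C) := by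
  subst hC
  have h := sum_norm_sq_alternating_swapOn
    (fun x : ((i : Fin n) → Fin (d i)) × ((i : Fin n) → Fin (d i)) => v x.1 * w x.2)
  simp only [← frobSq_ptrace_rank_one] at h
  have h2 := Finset.sum_nonneg fun x (_ : x ∈ Finset.univ) =>
    sq_nonneg ‖∑ J : Finset (Fin n), (-1 : ℂ) ^ J.card * (v (swapOn J x).1 * w (swapOn J x).2)‖
  norm_cast at h
  push_cast at h h2
  rw [h] at h2
  exact nonneg_of_mul_nonneg_right h2 (by positivity)
end

section
/- Let d₁, d₂ ≥ 1, let v, w : Fin d₁ × Fin d₂ → ℂ be nonzero vectors, and let C₂ : Matrix (Fin d₁ × Fin d₂) (Fin d₁ × Fin d₂) ℂ be a normal matrix (C₂ᴴ·C₂ = C₂·C₂ᴴ) such that C₂.mulVec v = 0 and C₂.mulVec w = 0 (i.e. v and w are orthogonal to the range of C₂, equivalently to all eigenvectors of C₂ with nonzero eigenvalue). Set C = v wᴴ + C₂ (where (v wᴴ) p q = v p · conj(w q)) and r = rank C. Then ‖tr₁ C‖₂² + ‖tr₂ C‖₂² ≤ r·‖C‖₂² + (1/r)·|tr C|². -/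
open Finset

open ComplexConjugate

/-- Standard sesquilinear form on `ι → ℂ`, conjugate linear in the first argument. -/
noncomputable def cdot {ι : Type*} [Fintype ι] (x y : ι → ℂ) : ℂ := ∑ p, conj (x p) * y p

/-- Squared Euclidean norm on `ι → ℂ`. -/
noncomputable def normSqSum {ι : Type*} [Fintype ι] (x : ι → ℂ) : ℝ := ∑ p, ‖x p‖ ^ 2

section vectors

variable {ι τ κ : Type*} [Fintype ι] [Fintype τ] [Fintype κ]

theorem cdot_self (x : ι → ℂ) : cdot x x = (normSqSum x : ℂ) := by
  simp [cdot, normSqSum, Complex.conj_mul']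

theorem conj_cdot (x y : ι → ℂ) : conj (cdot x y) = cdot y x := by
  simp [cdot, mul_comm]

theorem cdot_smul_left (c : ℂ) (x y : ι → ℂ) : cdot (c • x) y = conj c * cdot x y := by
  simp [cdot, Finset.mul_sum, mul_assoc]

theorem cdot_smul_right (c : ℂ) (x y : ι → ℂ) : cdot x (c • y) = c * cdot x y := by
  simp [cdot, Finset.mul_sum, mul_left_comm]

theorem cdot_sum_right (x : ι → ℂ) (f : τ → ι → ℂ) :
    cdot x (∑ i, f i) = ∑ i, cdot x (f i) := by
  simp only [cdot, Finset.sum_apply, Finset.mul_sum]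
  exact Finset.sum_comm

theorem cdot_zero_right (x : ι → ℂ) : cdot x 0 = 0 := by simp [cdot]

theorem cdot_sum_sum (f : τ → ι → ℂ) :
    cdot (fun p => ∑ i, f i p) (fun p => ∑ i, f i p) = ∑ i, ∑ j, cdot (f i) (f j) := by
  simp only [cdot, map_sum, Finset.sum_mul_sum]
  rw [Finset.sum_comm]
  exact Finset.sum_congr rfl fun i _ => Finset.sum_comm

theorem normSqSum_nonneg (x : ι → ℂ) : 0 ≤ normSqSum x :=
  Finset.sum_nonneg fun _ _ => by positivity

theorem normSqSum_pos {x : ι → ℂ} (hx : x ≠ 0) : 0 < normSqSum x := by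
  obtain ⟨p, hp⟩ := Function.ne_iff.mp hx
  exact Finset.sum_pos' (fun _ _ => by positivity)
    ⟨p, Finset.mem_univ p, by have : 0 < ‖x p‖ := norm_pos_iff.mpr hp; positivity⟩

theorem normSqSum_smul (c : ℂ) (x : ι → ℂ) : normSqSum (c • x) = ‖c‖ ^ 2 * normSqSum x := by
  simp [normSqSum, Finset.mul_sum, mul_pow]

theorem sum_norm_mul_norm_le (x y : ι → ℂ) :
    ∑ p, ‖x p‖ * ‖y p‖ ≤ √(normSqSum x) * √(normSqSum y) :=
  Real.sum_mul_le_sqrt_mul_sqrt _ _ _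

theorem norm_cdot_le (x y : ι → ℂ) : ‖cdot x y‖ ≤ √(normSqSum x) * √(normSqSum y) :=
  (norm_sum_le _ _).trans (by simpa using sum_norm_mul_norm_le x y)

/-- Weighted Cauchy–Schwarz inequality for a form with weights `1 - t` and `-t`. -/
theorem norm_weighted_cdot_le (t : ℝ) (ht₀ : 0 ≤ t) (ht : t ≤ 1 / 2)
    (x y : ι → ℂ) (x' y' : κ → ℂ) :
    ‖(1 - t : ℂ) * cdot x y - t * cdot x' y'‖ ≤
      (1 - t) * (√(normSqSum x + normSqSum x') * √(normSqSum y + normSqSum y')) := by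
  have h1 : ‖(1 - t : ℂ)‖ = 1 - t := by
    rw [← Complex.ofReal_one, ← Complex.ofReal_sub, Complex.norm_real, Real.norm_of_nonneg]
    linarith
  have h2 : ‖(t : ℂ)‖ = t := by rw [Complex.norm_real, Real.norm_of_nonneg ht₀]
  have key := sum_norm_mul_norm_le (Sum.elim x x') (Sum.elim y y')
  have e : ∀ (a : ι → ℂ) (b : κ → ℂ),
      normSqSum (Sum.elim a b) = normSqSum a + normSqSum b := by simp [normSqSum]
  rw [e, e] at key
  simp only [Fintype.sum_sum_type, Sum.elim_inl, Sum.elim_inr] at key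
  have hx : ‖cdot x y‖ ≤ ∑ p, ‖x p‖ * ‖y p‖ := (norm_sum_le _ _).trans (by simp)
  have hx' : ‖cdot x' y'‖ ≤ ∑ p, ‖x' p‖ * ‖y' p‖ := (norm_sum_le _ _).trans (by simp)
  calc _ ≤ ‖(1 - t : ℂ) * cdot x y‖ + ‖(t : ℂ) * cdot x' y'‖ := norm_sub_le _ _
    _ = (1 - t) * ‖cdot x y‖ + t * ‖cdot x' y'‖ := by rw [norm_mul, norm_mul, h1, h2]
    _ ≤ (1 - t) * ‖cdot x y‖ + (1 - t) * ‖cdot x' y'‖ := by gcongr; linarith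
    _ ≤ (1 - t) * (∑ p, ‖x p‖ * ‖y p‖ + ∑ p, ‖x' p‖ * ‖y' p‖) := by
        rw [← mul_add]; exact mul_le_mul_of_nonneg_left (add_le_add hx hx') (by linarith)
    _ ≤ _ := mul_le_mul_of_nonneg_left key (by linarith)

/-- A Gershgorin-type estimate for a sum of vectors whose Gram matrix is close to a rank-one
matrix off the diagonal. -/
theorem normSqSum_sum_le [Nonempty τ] [DecidableEq τ] (D : τ → κ → ℂ) (a : τ → ℂ) (n : τ → ℝ)
    (hdiag : ∀ i, normSqSum (D i) ≤ n i ^ 2 + ‖a i‖ ^ 2) (ha : ∀ i, ‖a i‖ ^ 2 ≤ n i ^ 2)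
    (hoff : ∀ i j, i ≠ j →
      ‖cdot (D i) (D j) - ((1 / Fintype.card τ : ℝ) : ℂ) * (conj (a i) * a j)‖ ≤
        (1 - 1 / (Fintype.card τ : ℝ)) * (n i * n j)) :
    normSqSum (fun k => ∑ i, D i k) ≤
      (Fintype.card τ : ℝ) * ∑ i, n i ^ 2 + 1 / (Fintype.card τ : ℝ) * ‖∑ i, a i‖ ^ 2 := by
  set r : ℝ := (Fintype.card τ : ℝ) with hr
  have hr1 : 1 ≤ r := by rw [hr]; exact_mod_cast Fintype.card_pos
  set E : τ → τ → ℂ := fun i j => cdot (D i) (D j) - ((1 / r : ℝ) : ℂ) * (conj (a i) * a j)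
    with hE
  have hsum : ((normSqSum (fun k => ∑ i, D i k) - 1 / r * ‖∑ i, a i‖ ^ 2 : ℝ) : ℂ) =
      ∑ i, ∑ j, E i j := by
    have h1 : ((‖∑ i, a i‖ ^ 2 : ℝ) : ℂ) = ∑ i, ∑ j, conj (a i) * a j := by
      rw [Complex.ofReal_pow, ← Complex.conj_mul', map_sum, Finset.sum_mul_sum]
    simp only [hE, Finset.sum_sub_distrib, ← Finset.mul_sum]
    rw [Complex.ofReal_sub, ← cdot_self, cdot_sum_sum, Complex.ofReal_mul, h1]
    simp only [← Finset.mul_sum]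
  have hbd : ∀ i j, (E i j).re ≤ (1 - 1 / r) * (n i * n j) + if i = j then n i ^ 2 else 0 := by
    intro i j
    by_cases hij : i = j
    · subst hij
      have : E i i = ((normSqSum (D i) - 1 / r * ‖a i‖ ^ 2 : ℝ) : ℂ) := by
        simp only [hE]
        rw [cdot_self, Complex.conj_mul']
        push_cast
        ring
      rw [this, Complex.ofReal_re, if_pos rfl]
      have h0 : 0 ≤ 1 - 1 / r := by
        rw [sub_nonneg, div_le_one (by linarith)]; exact hr1
      nlinarith [hdiag i, mul_le_mul_of_nonneg_left (ha i) h0]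
    · rw [if_neg hij, add_zero]
      exact (Complex.re_le_norm _).trans (hoff i j hij)
  have hre : normSqSum (fun k => ∑ i, D i k) - 1 / r * ‖∑ i, a i‖ ^ 2 = ∑ i, ∑ j, (E i j).re := by
    have := congrArg Complex.re hsum
    simpa only [Complex.ofReal_re, Complex.re_sum] using this
  have hle : ∑ i, ∑ j, (E i j).re ≤ (1 - 1 / r) * (∑ i, n i) ^ 2 + ∑ i, n i ^ 2 := by
    refine (Finset.sum_le_sum fun i _ => Finset.sum_le_sum fun j _ => hbd i j).trans_eq ?_
    simp only [Finset.sum_add_distrib, Finset.sum_ite_eq, Finset.mem_univ, if_true,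
      ← Finset.mul_sum, ← Finset.sum_mul, sq]
  have hcs : (∑ i, n i) ^ 2 ≤ r * ∑ i, n i ^ 2 := by
    simpa [hr] using sq_sum_le_card_mul_sum_sq (s := Finset.univ) (f := n)
  have h0 : 0 ≤ 1 - 1 / r := by
    rw [sub_nonneg, div_le_one (by linarith)]; exact hr1
  have h2 := mul_le_mul_of_nonneg_left hcs h0
  have h3 : (1 - 1 / r) * (r * ∑ i, n i ^ 2) = r * (∑ i, n i ^ 2) - ∑ i, n i ^ 2 := by
    field_simp
  linarith

end vectors

/-- Antisymmetrization of a four-index array in its first two and in its last two indices. -/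
def antisymmetrize {α β : Type*} (f : α → α → β → β → ℂ) (i i' : α) (j j' : β) : ℂ :=
  f i i' j j' - f i' i j j' - f i i' j' j + f i' i j' j

theorem sum_antisymmetrize_muletrize {α β : Type*} [Fintype α] [Fintype β]
    (f g : α → α → β → β → ℂ) :
    ∑ i, ∑ i', ∑ j, ∑ j', antisymmetrize f i i' j j' * antisymmetrize g i i' j j' =
      4 * ∑ i, ∑ i', ∑ j, ∑ j', f i i' j j' * antisymmetrize g i i' j j' := by
  have h1 : ∀ i i' j j', antisymmetrize g i' i j j' = - antisymmetrize g i i' j j' := by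
    intros; simp only [antisymmetrize]; ring
  have h2 : ∀ i i' j j', antisymmetrize g i i' j' j = - antisymmetrize g i i' j j' := by
    intros; simp only [antisymmetrize]; ring
  have s1 : ∀ f : α → α → β → β → ℂ,
      ∑ i, ∑ i', ∑ j, ∑ j', f i' i j j' * antisymmetrize g i i' j j' =
      - ∑ i, ∑ i', ∑ j, ∑ j', f i i' j j' * antisymmetrize g i i' j j' := by
    intro f
    rw [Finset.sum_comm]
    simp only [← Finset.sum_neg_distrib]
    refine Finset.sum_congr rfl fun i _ => Finset.sum_congr rfl fun i' _ =>
      Finset.sum_congr rfl fun j _ => Finset.sum_congr rfl fun j' _ => ?_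
    rw [h1]; ring
  have s2 : ∀ f : α → α → β → β → ℂ,
      ∑ i, ∑ i', ∑ j, ∑ j', f i i' j' j * antisymmetrize g i i' j j' =
      - ∑ i, ∑ i', ∑ j, ∑ j', f i i' j j' * antisymmetrize g i i' j j' := by
    intro f
    simp only [← Finset.sum_neg_distrib]
    refine Finset.sum_congr rfl fun i _ => Finset.sum_congr rfl fun i' _ => ?_
    rw [Finset.sum_comm]
    refine Finset.sum_congr rfl fun j _ => Finset.sum_congr rfl fun j' _ => ?_
    rw [h2]; ring
  have s3 : ∑ i, ∑ i', ∑ j, ∑ j', f i' i j' j * antisymmetrize g i i' j j' =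
      ∑ i, ∑ i', ∑ j, ∑ j', f i i' j j' * antisymmetrize g i i' j j' := by
    rw [s2 fun i i' j j' => f i' i j j', s1 f, neg_neg]
  simp only [antisymmetrize.eq_def f, add_mul, sub_mul, Finset.sum_add_distrib, Finset.sum_sub_distrib]
  rw [s1 f, s2 f, s3]
  ring

/-- Inner product of the partial traces of `x yᴴ` and `v wᴴ`, summed over both factors. -/
noncomputable def swapForm {α β : Type*} [Fintype α] [Fintype β] (x y v w : α × β → ℂ) : ℂ :=
  ∑ i, ∑ i', ∑ j, ∑ j', conj (x (i, j)) * conj (w (i', j')) *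
    (y (i', j) * v (i, j') + y (i, j') * v (i', j))

/-- The tensor `y ⊗ v` antisymmetrized in both factors. -/
def wedgeVec {α β : Type*} (y v : α × β → ℂ) (s : (α × α) × (β × β)) : ℂ :=
  antisymmetrize (fun i i' j j' => y (i, j) * v (i', j')) s.1.1 s.1.2 s.2.1 s.2.2

theorem wedgeVec_comm {α β : Type*} (y v : α × β → ℂ) : wedgeVec y v = wedgeVec v y := by
  funext s
  simp only [wedgeVec, antisymmetrize]
  ring

theorem cdot_wedgeVec {α β : Type*} [Fintype α] [Fintype β] (x y v w : α × β → ℂ) :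
    cdot (wedgeVec x w) (wedgeVec y v) =
      4 * (cdot x y * cdot w v + cdot x v * cdot w y - swapForm x y v w) := by
  have h1 : cdot (wedgeVec x w) (wedgeVec y v) =
      ∑ i, ∑ i', ∑ j, ∑ j', antisymmetrize (fun i i' j j' => conj (x (i, j)) * conj (w (i', j'))) i i' j j'
        * antisymmetrize (fun i i' j j' => y (i, j) * v (i', j')) i i' j j' := by
    simp only [cdot, wedgeVec, Fintype.sum_prod_type, antisymmetrize, map_sub, map_add, map_mul]
  have h2 : ∀ y v : α × β → ℂ, cdot x y * cdot w v =
      ∑ i, ∑ i', ∑ j, ∑ j', conj (x (i, j)) * conj (w (i', j')) * (y (i, j) * v (i', j')) := by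
    intro y v
    simp only [cdot, Fintype.sum_prod_type, Finset.sum_mul_sum]
    refine Finset.sum_congr rfl fun i _ => Finset.sum_congr rfl fun i' _ =>
      Finset.sum_congr rfl fun j _ => Finset.sum_congr rfl fun j' _ => ?_
    ring
  rw [h1, sum_antisymmetrize_muletrize, h2, h2, swapForm]
  simp only [← Finset.sum_add_distrib, ← Finset.sum_sub_distrib]
  congr 1
  refine Finset.sum_congr rfl fun i _ => Finset.sum_congr rfl fun i' _ =>
      Finset.sum_congr rfl fun j _ => Finset.sum_congr rfl fun j' _ => ?_
  simp only [antisymmetrize]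
  ring

/-- The two partial traces of `C`, collected in a single vector. -/
noncomputable def ptrVec {d₁ d₂ : ℕ} (C : Matrix (Fin d₁ × Fin d₂) (Fin d₁ × Fin d₂) ℂ) :
    (Fin d₂ × Fin d₂) ⊕ (Fin d₁ × Fin d₁) → ℂ :=
  Sum.elim (fun s => ptr1 C s.1 s.2) (fun s => ptr2 C s.1 s.2)

theorem normSqSum_ptrVec {d₁ d₂ : ℕ} (C : Matrix (Fin d₁ × Fin d₂) (Fin d₁ × Fin d₂) ℂ) :
    normSqSum (ptrVec C) = frobSq (ptr1 C) + frobSq (ptr2 C) := by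
  simp [normSqSum, ptrVec, frobSq, Fintype.sum_prod_type]

theorem ptrVec_sum {d₁ d₂ : ℕ} {τ : Type*} [Fintype τ]
    (X : τ → Matrix (Fin d₁ × Fin d₂) (Fin d₁ × Fin d₂) ℂ) :
    ptrVec (∑ i, X i) = fun s => ∑ i, ptrVec (X i) s := by
  funext s
  rcases s with s | s <;> simp only [ptrVec, ptr1, ptr2, Matrix.sum_apply, Sum.elim_inl,
    Sum.elim_inr, Matrix.of_apply] <;> exact Finset.sum_comm

/-- The rank-one matrix `x yᴴ`. -/
noncomputable def outer {ι : Type*} (x y : ι → ℂ) : Matrix ι ι ℂ :=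
  Matrix.of fun p q => x p * conj (y q)

theorem outer_mulVec {ι : Type*} [Fintype ι] (x y z : ι → ℂ) :
    (outer x y).mulVec z = cdot y z • x := by
  funext p
  simp only [Matrix.mulVec, dotProduct, outer, Matrix.of_apply, cdot, Pi.smul_apply,
    smul_eq_mul, Finset.sum_mul]
  exact Finset.sum_congr rfl fun q _ => by ring

theorem trace_outer {ι : Type*} [Fintype ι] (x y : ι → ℂ) : (outer x y).trace = cdot y x := by
  simp [outer, Matrix.trace, cdot, mul_comm]

theorem cdot_ptrVec_outer {d₁ d₂ : ℕ} (x y v w : Fin d₁ × Fin d₂ → ℂ) :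
    cdot (ptrVec (outer x y)) (ptrVec (outer v w)) = swapForm x y v w := by
  simp only [cdot, ptrVec, Fintype.sum_sum_type, Sum.elim_inl, Sum.elim_inr, ptr1, ptr2, outer,
    Matrix.of_apply, Fintype.sum_prod_type, map_sum, Finset.sum_mul_sum, swapForm, mul_add,
    Finset.sum_add_distrib]
  rw [add_comm]
  congr 1
  · refine Finset.sum_congr rfl fun i _ => Finset.sum_congr rfl fun i' _ =>
      Finset.sum_congr rfl fun j _ => Finset.sum_congr rfl fun j' _ => ?_
    simp only [map_mul, Complex.conj_conj]
    ring
  · calc _ = ∑ j, ∑ i, ∑ i', ∑ j', conj (x (i, j) * conj (y (i, j'))) *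
          (v (i', j) * conj (w (i', j'))) := by
          refine Finset.sum_congr rfl fun j _ => ?_
          rw [Finset.sum_comm]
          refine Finset.sum_congr rfl fun i _ => ?_
          rw [Finset.sum_comm]
      _ = _ := by
          rw [Finset.sum_comm]
          refine Finset.sum_congr rfl fun i _ => ?_
          rw [Finset.sum_comm]
          refine Finset.sum_congr rfl fun i' _ =>
            Finset.sum_congr rfl fun j _ => Finset.sum_congr rfl fun j' _ => ?_
          simp only [map_mul, Complex.conj_conj]
          ring

/-- The contractions of `conj u ⊗ v` over each of the two factors. -/
noncomputable def contractVec {d₁ d₂ : ℕ} (u v : Fin d₁ × Fin d₂ → ℂ) :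
    (Fin d₂ × Fin d₂) ⊕ (Fin d₁ × Fin d₁) → ℂ :=
  Sum.elim (fun s => ∑ i, conj (u (i, s.1)) * v (i, s.2))
    (fun s => ∑ j, conj (u (s.1, j)) * v (s.2, j))

theorem cdot_contractVec {d₁ d₂ : ℕ} (u v w : Fin d₁ × Fin d₂ → ℂ) :
    cdot (contractVec u w) (contractVec u v) = swapForm u u v w := by
  simp only [cdot, contractVec, Fintype.sum_sum_type, Sum.elim_inl, Sum.elim_inr,
    Fintype.sum_prod_type, map_sum, Finset.sum_mul_sum, swapForm, mul_add,
    Finset.sum_add_distrib]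
  congr 1
  · calc _ = ∑ j, ∑ i', ∑ i, ∑ j', conj (conj (u (i', j)) * w (i', j')) *
          (conj (u (i, j)) * v (i, j')) := by
          refine Finset.sum_congr rfl fun j _ => ?_
          rw [Finset.sum_comm]
          refine Finset.sum_congr rfl fun i _ => ?_
          rw [Finset.sum_comm]
      _ = _ := by
          rw [Finset.sum_comm]
          conv_rhs => rw [Finset.sum_comm]
          refine Finset.sum_congr rfl fun i' _ => ?_
          rw [Finset.sum_comm]
          refine Finset.sum_congr rfl fun i _ =>
            Finset.sum_congr rfl fun j _ => Finset.sum_congr rfl fun j' _ => ?_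
          simp only [map_mul, Complex.conj_conj]
          ring
  · refine Finset.sum_congr rfl fun i _ => Finset.sum_congr rfl fun i' _ => ?_
    rw [Finset.sum_comm]
    refine Finset.sum_congr rfl fun j _ => Finset.sum_congr rfl fun j' _ => ?_
    simp only [map_mul, Complex.conj_conj]
    ring

/-- The rank-one case of the partial trace inequality. -/
theorem normSqSum_ptrVec_outer_le {d₁ d₂ : ℕ} (v w : Fin d₁ × Fin d₂ → ℂ) :
    normSqSum (ptrVec (outer v w)) ≤ normSqSum v * normSqSum w + ‖cdot w v‖ ^ 2 := by
  have h := cdot_wedgeVec v w v w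
  rw [wedgeVec_comm w v, ← cdot_ptrVec_outer, cdot_self, cdot_self, cdot_self, cdot_self, ← conj_cdot w v,
    Complex.conj_mul'] at h
  have h' : normSqSum (wedgeVec v w) =
      4 * (‖cdot w v‖ ^ 2 + normSqSum v * normSqSum w - normSqSum (ptrVec (outer v w))) := by
    exact_mod_cast h
  have := normSqSum_nonneg (wedgeVec v w)
  linarith

theorem norm_cdot_ptrVec_outer_self_sub_le {d₁ d₂ : ℕ} (u v w : Fin d₁ × Fin d₂ → ℂ)
    (huv : cdot u v = 0) (huw : cdot u w = 0) (t : ℝ) (ht₀ : 0 ≤ t) (ht : t ≤ 1 / 2) :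
    ‖cdot (ptrVec (outer u u)) (ptrVec (outer v w)) - t * (normSqSum u * cdot w v)‖ ≤
      (1 - t) * (normSqSum u * (√(normSqSum v) * √(normSqSum w))) := by
  have key : ∀ v w : Fin d₁ × Fin d₂ → ℂ, cdot u v = 0 →
      cdot (contractVec u w) (contractVec u v) +
        cdot ((1 / 2 : ℂ) • wedgeVec u w) ((1 / 2 : ℂ) • wedgeVec u v) =
      normSqSum u * cdot w v := by
    intro v w huv
    rw [cdot_smul_left, cdot_smul_right, cdot_wedgeVec, cdot_contractVec, huv, cdot_self]
    simp only [map_div₀, map_one, map_ofNat]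
    ring
  have hn : ∀ v : Fin d₁ × Fin d₂ → ℂ, cdot u v = 0 →
      normSqSum (contractVec u v) + normSqSum ((1 / 2 : ℂ) • wedgeVec u v) =
      normSqSum u * normSqSum v := by
    intro v huv
    have h := key v v huv
    rw [cdot_self, cdot_self, cdot_self] at h
    exact_mod_cast h
  have h := norm_weighted_cdot_le t ht₀ ht (contractVec u w) (contractVec u v)
    ((1 / 2 : ℂ) • wedgeVec u w) ((1 / 2 : ℂ) • wedgeVec u v)
  rw [hn v huv, hn w huw, Real.sqrt_mul (normSqSum_nonneg u),
    Real.sqrt_mul (normSqSum_nonneg u)] at h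
  rw [cdot_ptrVec_outer, ← cdot_contractVec, ← key v w huv]
  convert h using 1
  · congr 1
    ring
  · nth_rewrite 1 [← Real.mul_self_sqrt (normSqSum_nonneg u)]
    ring

theorem ptrVec_outer_smul_left {d₁ d₂ : ℕ} (c : ℂ) (x y : Fin d₁ × Fin d₂ → ℂ) :
    ptrVec (outer (c • x) y) = c • ptrVec (outer x y) := by
  funext s
  rcases s with s | s <;> simp [ptrVec, ptr1, ptr2, outer, Finset.mul_sum, mul_assoc]

theorem norm_cdot_ptrVec_outer_sub_le {d₁ d₂ : ℕ} (c : ℂ) (u v w : Fin d₁ × Fin d₂ → ℂ)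
    (huv : cdot u v = 0) (huw : cdot u w = 0) (t : ℝ) (ht₀ : 0 ≤ t) (ht : t ≤ 1 / 2) :
    ‖cdot (ptrVec (outer (c • u) u)) (ptrVec (outer v w)) -
        t * (conj (cdot u (c • u)) * cdot w v)‖ ≤
      (1 - t) * (√(normSqSum (c • u)) * √(normSqSum u) *
        (√(normSqSum v) * √(normSqSum w))) := by
  have h := mul_le_mul_of_nonneg_left
    (norm_cdot_ptrVec_outer_self_sub_le u v w huv huw t ht₀ ht) (norm_nonneg (conj c))
  rw [← norm_mul] at h
  rw [ptrVec_outer_smul_left, cdot_smul_left, cdot_smul_right, cdot_self, normSqSum_smul,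
    Real.sqrt_mul (sq_nonneg ‖c‖), Real.sqrt_sq (norm_nonneg c), mul_assoc ‖c‖,
    Real.mul_self_sqrt (normSqSum_nonneg u)]
  refine le_of_eq_of_le ?_ (h.trans_eq ?_)
  · rw [map_mul, Complex.conj_ofReal]
    congr 1
    ring
  · rw [RCLike.norm_conj]
    ring

theorem frobSq_sum_outer {ι τ : Type*} [Fintype ι] [Fintype τ] (x y : τ → ι → ℂ)
    (hx : ∀ i j, i ≠ j → cdot (x i) (x j) = 0) :
    frobSq (∑ i, outer (x i) (y i)) = ∑ i, normSqSum (x i) * normSqSum (y i) := by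
  classical
  set f : τ → ι × ι → ℂ := fun i s => x i s.1 * conj (y i s.2) with hf
  have h1 : frobSq (∑ i, outer (x i) (y i)) = normSqSum (fun s => ∑ i, f i s) := by
    simp [frobSq, normSqSum, Fintype.sum_prod_type, Matrix.sum_apply, outer, hf]
  have h2 : ∀ i j, cdot (f i) (f j) = cdot (x i) (x j) * cdot (y j) (y i) := by
    intro i j
    simp only [cdot, hf, Fintype.sum_prod_type, Finset.sum_mul_sum]
    refine Finset.sum_congr rfl fun p _ => Finset.sum_congr rfl fun q _ => ?_
    simp only [map_mul, Complex.conj_conj]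
    ring
  rw [h1]
  apply Complex.ofReal_injective
  rw [← cdot_self, cdot_sum_sum]
  push_cast
  refine Finset.sum_congr rfl fun i _ => ?_
  rw [Finset.sum_eq_single i, h2, cdot_self, cdot_self]
  · intro j _ hj
    rw [h2, hx i j hj.symm, zero_mul]
  · simp

theorem rank_sum_outer {ι τ : Type*} [Fintype ι] [Fintype τ] (x y : τ → ι → ℂ)
    (hx0 : ∀ i, x i ≠ 0) (hy0 : ∀ i, y i ≠ 0)
    (hx : ∀ i j, i ≠ j → cdot (x i) (x j) = 0) (hy : ∀ i j, i ≠ j → cdot (y i) (y j) = 0) :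
    (∑ i, outer (x i) (y i)).rank = Fintype.card τ := by
  classical
  apply le_antisymm
  · have hle : LinearMap.range (∑ i, outer (x i) (y i)).mulVecLin ≤
        Submodule.span ℂ (Set.range x) := by
      rintro _ ⟨z, rfl⟩
      rw [Matrix.mulVecLin_apply, Matrix.sum_mulVec]
      refine Submodule.sum_mem _ fun i _ => ?_
      rw [outer_mulVec]
      exact Submodule.smul_mem _ _ (Submodule.subset_span ⟨i, rfl⟩)
    exact (Submodule.finrank_mono hle).trans (finrank_range_le_card x)
  · have hli : LinearIndependent ℂ x := by
      rw [Fintype.linearIndependent_iff]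
      intro g hg i
      have h : cdot (x i) (∑ j, g j • x j) = g i * cdot (x i) (x i) := by
        rw [cdot_sum_right, Finset.sum_eq_single i, cdot_smul_right]
        · intro j _ hj
          rw [cdot_smul_right, hx i j hj.symm, mul_zero]
        · simp
      rw [hg, cdot_self, cdot_zero_right] at h
      have hne : (normSqSum (x i) : ℂ) ≠ 0 := by
        exact_mod_cast (normSqSum_pos (hx0 i)).ne'
      exact (mul_eq_zero.mp h.symm).resolve_right hne
    have hmem : ∀ i, x i ∈ LinearMap.range (∑ i, outer (x i) (y i)).mulVecLin := by
      intro i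
      have hne : (normSqSum (y i) : ℂ) ≠ 0 := by
        exact_mod_cast (normSqSum_pos (hy0 i)).ne'
      refine ⟨(normSqSum (y i) : ℂ)⁻¹ • y i, ?_⟩
      have h : (∑ j, outer (x j) (y j)).mulVec (y i) = (normSqSum (y i) : ℂ) • x i := by
        rw [Matrix.sum_mulVec, Finset.sum_eq_single i, outer_mulVec, cdot_self]
        · intro j _ hj
          rw [outer_mulVec, hy j i hj, zero_smul]
        · simp
      rw [Matrix.mulVecLin_apply, Matrix.mulVec_smul, h, smul_smul, inv_mul_cancel₀ hne, one_smul]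
    have h := LinearIndependent.fintype_card_le_finrank
      (b := fun i => (⟨x i, hmem i⟩ : LinearMap.range (∑ i, outer (x i) (y i)).mulVecLin))
      (LinearIndependent.of_comp (Submodule.subtype _) hli)
    exact h

/-- The rank bound for a sum of rank-one matrices `xᵢ yᵢᴴ` with orthogonal `xᵢ` and orthogonal
`yᵢ`, such that `xᵢ` is a multiple of `yᵢ` for all but at most one index. -/
theorem sum_partial_traces_outer_le {d₁ d₂ : ℕ} {τ : Type*} [Fintype τ] [Nonempty τ]
    (x y : τ → Fin d₁ × Fin d₂ → ℂ) (hx0 : ∀ i, x i ≠ 0) (hy0 : ∀ i, y i ≠ 0)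
    (hx : ∀ i j, i ≠ j → cdot (x i) (x j) = 0) (hy : ∀ i j, i ≠ j → cdot (y i) (y j) = 0)
    (hxy : ∀ i j, i ≠ j → cdot (y i) (x j) = 0)
    (H : ∀ i j, i ≠ j → (∃ c : ℂ, x i = c • y i) ∨ ∃ c : ℂ, x j = c • y j)
    (C : Matrix (Fin d₁ × Fin d₂) (Fin d₁ × Fin d₂) ℂ) (hC : C = ∑ i, outer (x i) (y i)) :
    frobSq (ptr1 C) + frobSq (ptr2 C)
      ≤ (C.rank : ℝ) * frobSq C + (1 / (C.rank : ℝ)) * ‖C.trace‖ ^ 2 := by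
  classical
  have hn : ∀ i, (√(normSqSum (x i)) * √(normSqSum (y i))) ^ 2 =
      normSqSum (x i) * normSqSum (y i) := fun i => by
    rw [mul_pow, Real.sq_sqrt (normSqSum_nonneg _), Real.sq_sqrt (normSqSum_nonneg _)]
  have hoff : ∀ i j, i ≠ j → (∃ c : ℂ, x i = c • y i) →
      ‖cdot (ptrVec (outer (x i) (y i))) (ptrVec (outer (x j) (y j))) -
        ((1 / Fintype.card τ : ℝ) : ℂ) * (conj (cdot (y i) (x i)) * cdot (y j) (x j))‖ ≤
        (1 - 1 / (Fintype.card τ : ℝ)) * (√(normSqSum (x i)) * √(normSqSum (y i)) *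
          (√(normSqSum (x j)) * √(normSqSum (y j)))) := by
    rintro i j hij ⟨c, hc⟩
    have hcard : (2 : ℝ) ≤ Fintype.card τ := by
      exact_mod_cast Fintype.one_lt_card_iff.mpr ⟨i, j, hij⟩
    rw [hc]
    exact norm_cdot_ptrVec_outer_sub_le c (y i) (x j) (y j) (hxy i j hij) (hy i j hij) _
      (by positivity) (one_div_le_one_div_of_le (by norm_num) hcard)
  have h := normSqSum_sum_le (fun i => ptrVec (outer (x i) (y i))) (fun i => cdot (y i) (x i))
    (fun i => √(normSqSum (x i)) * √(normSqSum (y i)))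
    (fun i => by rw [hn]; exact normSqSum_ptrVec_outer_le _ _)
    (fun i => by
      rw [mul_comm √(normSqSum (x i))]
      exact pow_le_pow_left₀ (norm_nonneg _) (norm_cdot_le _ _) 2)
    (fun i j hij => by
      rcases H i j hij with hi | hj
      · exact hoff i j hij hi
      · have h := hoff j i hij.symm hj
        rw [← RCLike.norm_conj, map_sub, map_mul, map_mul, conj_cdot, Complex.conj_conj,
          Complex.conj_ofReal, mul_comm (cdot (y j) (x j)),
          mul_comm (√(normSqSum (x j)) * √(normSqSum (y j)))] at h
        exact h)
  rw [hC, rank_sum_outer x y hx0 hy0 hx hy, frobSq_sum_outer x y hx, ← normSqSum_ptrVec,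
    ptrVec_sum, Matrix.trace_sum]
  simpa only [hn, trace_outer] using h

/-- A normal matrix has an orthonormal basis of eigenvectors. -/
theorem exists_orthonormalBasis_mulVec_eq_smul {ι : Type*} [Fintype ι] [DecidableEq ι]
    (M : Matrix ι ι ℂ) (hM : M.conjTranspose * M = M * M.conjTranspose) :
    ∃ (n : ℕ) (b : OrthonormalBasis (Fin n) ℂ (EuclideanSpace ℂ ι)) (c : Fin n → ℂ),
      ∀ k, M.mulVec (b k).ofLp = c k • (b k).ofLp := by
  classical
  set A : Matrix ι ι ℂ := M + M.conjTranspose with hA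
  set B : Matrix ι ι ℂ := Complex.I • (M - M.conjTranspose) with hB
  have hAh : A.IsHermitian := by
    simp [hA, Matrix.IsHermitian, Matrix.conjTranspose_add, add_comm]
  have hBh : B.IsHermitian := by
    simp [hB, Matrix.IsHermitian, Matrix.conjTranspose_smul, Matrix.conjTranspose_sub,
      ← smul_neg]
  have hAs := Matrix.isSymmetric_toEuclideanLin_iff.mpr hAh
  have hBs := Matrix.isSymmetric_toEuclideanLin_iff.mpr hBh
  have hAB : A * B = B * A := by
    simp only [hA, hB, Matrix.mul_smul, Matrix.smul_mul, add_mul, mul_add, sub_mul, mul_sub, hM]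
  have hcomm : Commute (Matrix.toEuclideanLin A) (Matrix.toEuclideanLin B) := by
    apply LinearMap.ext
    intro x
    simp [Matrix.toLpLin_apply, Matrix.mulVec_mulVec, hAB]
  have hint := LinearMap.IsSymmetric.directSum_isInternal_of_commute hAs hBs hcomm
  have hfam := LinearMap.IsSymmetric.orthogonalFamily_eigenspace_inf_eigenspace hAs hBs
  have hfin := WellFoundedGT.finite_ne_bot_of_iSupIndep hint.submodule_iSupIndep
  have hint' := DirectSum.isInternal_ne_bot_iff.mpr hint
  have : Fintype {i : ℂ × ℂ // Module.End.eigenspace (Matrix.toEuclideanLin A) i.2 ⊓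
    Module.End.eigenspace (Matrix.toEuclideanLin B) i.1 ≠ ⊥} := hfin.fintype
  have hfam' := hfam.comp (γ := {i : ℂ × ℂ // Module.End.eigenspace (Matrix.toEuclideanLin A) i.2 ⊓
    Module.End.eigenspace (Matrix.toEuclideanLin B) i.1 ≠ ⊥}) Subtype.val_injective
  refine ⟨_, hint'.subordinateOrthonormalBasis rfl hfam',
    fun k => ((hint'.subordinateOrthonormalBasisIndex rfl k hfam').1.2 -
      Complex.I * (hint'.subordinateOrthonormalBasisIndex rfl k hfam').1.1) / 2, fun k => ?_⟩
  obtain ⟨h1, h2⟩ := hint'.subordinateOrthonormalBasis_subordinate rfl k hfam'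
  rw [SetLike.mem_coe, Module.End.mem_eigenspace_iff] at h1 h2
  set x := hint'.subordinateOrthonormalBasis rfl hfam' k
  set z := (hint'.subordinateOrthonormalBasisIndex rfl k hfam').1
  have h1' : A.mulVec x.ofLp = z.2 • x.ofLp := congrArg WithLp.ofLp h1
  have h2' : B.mulVec x.ofLp = z.1 • x.ofLp := congrArg WithLp.ofLp h2
  have hMAB : M = (1 / 2 : ℂ) • (A - Complex.I • B) := by
    simp only [hA, hB, smul_smul, Complex.I_mul_I]
    module
  rw [hMAB, Matrix.smul_mulVec, Matrix.sub_mulVec, Matrix.smul_mulVec, h1', h2']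
  module

theorem cdot_eq_inner {ι : Type*} [Fintype ι] (x y : EuclideanSpace ℂ ι) :
    cdot x.ofLp y.ofLp = inner ℂ x y := by
  simp [cdot, PiLp.inner_apply, mul_comm]

/-- Spectral decomposition of a normal matrix over its nonzero eigenvalues. -/
theorem exists_eq_sum_outer {ι : Type*} [Fintype ι] [DecidableEq ι]
    (M : Matrix ι ι ℂ) (hM : M.conjTranspose * M = M * M.conjTranspose) :
    ∃ (τ : Type) (_ : Fintype τ) (u : τ → ι → ℂ) (c : τ → ℂ),
      (∀ k, c k ≠ 0) ∧ (∀ k, u k ≠ 0) ∧ (∀ k l, k ≠ l → cdot (u k) (u l) = 0) ∧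
      M = ∑ k, outer (c k • u k) (u k) := by
  classical
  obtain ⟨n, b, c, hb⟩ := exists_orthonormalBasis_mulVec_eq_smul M hM
  have horth : ∀ k l, cdot (b k).ofLp (b l).ofLp = if k = l then 1 else 0 := fun k l => by
    rw [cdot_eq_inner]
    exact orthonormal_iff_ite.mp b.orthonormal k l
  refine ⟨{k // c k ≠ 0}, inferInstance, fun k => (b k.1).ofLp, fun k => c k.1, fun k => k.2,
    fun k h => ?_, fun k l hkl => ?_, ?_⟩
  · have := horth k.1 k.1
    simp [h, cdot] at this
  · rw [horth, if_neg (Subtype.coe_injective.ne hkl)]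
  · have hsum : ∑ k : {k // c k ≠ 0}, outer (c k.1 • (b k.1).ofLp) (b k.1).ofLp =
        ∑ k, outer (c k • (b k).ofLp) (b k).ofLp := by
      rw [← Finset.sum_filter_of_ne (p := fun k => c k ≠ 0), ← Finset.sum_subtype_eq_sum_filter,
        Finset.subtype_univ]
      intro k _ hk hck
      refine hk ?_
      ext p q
      simp [outer, hck]
    rw [hsum]
    apply Matrix.toEuclideanLin.injective
    refine b.toBasis.ext fun l => ?_
    rw [OrthonormalBasis.coe_toBasis]
    apply WithLp.ofLp_injective
    change M.mulVec (b l).ofLp = (∑ k, outer (c k • (b k).ofLp) (b k).ofLp).mulVec (b l).ofLp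
    rw [hb, Matrix.sum_mulVec, Finset.sum_eq_single l, outer_mulVec, horth, if_pos rfl, one_smul]
    · intro k _ hk
      rw [outer_mulVec, horth, if_neg hk, zero_smul]
    · simp

theorem cdot_eq_zero_of_sum_outer_mulVec_eq_zero {ι τ : Type*} [Fintype ι] [Fintype τ]
    (u : τ → ι → ℂ) (c : τ → ℂ) (hc : ∀ k, c k ≠ 0) (hu : ∀ k, u k ≠ 0)
    (horth : ∀ k l, k ≠ l → cdot (u k) (u l) = 0) (z : ι → ℂ)
    (hz : (∑ k, outer (c k • u k) (u k)).mulVec z = 0) (k : τ) : cdot (u k) z = 0 := by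
  classical
  have h : cdot (u k) (∑ l, (cdot (u l) z * c l) • u l) =
      cdot (u k) z * c k * cdot (u k) (u k) := by
    rw [cdot_sum_right, Finset.sum_eq_single k, cdot_smul_right]
    · intro l _ hl
      rw [cdot_smul_right, horth k l hl.symm, mul_zero]
    · simp
  rw [Matrix.sum_mulVec] at hz
  simp only [outer_mulVec, smul_smul] at hz
  rw [hz, cdot_zero_right, cdot_self] at h
  have hne : (normSqSum (u k) : ℂ) ≠ 0 := by exact_mod_cast (normSqSum_pos (hu k)).ne'
  exact (mul_eq_zero.mp ((mul_eq_zero.mp h.symm).resolve_right hne)).resolve_right (hc k)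

/-- Rank bound for `C = v wᴴ + C₂` with `C₂` normal and `v`, `w` orthogonal to all
eigenvectors of `C₂`: with `r = rank C`,
`‖tr₁C‖₂² + ‖tr₂C‖₂² ≤ r‖C‖₂² + (1/r)|tr C|²`. -/
theorem sum_partial_traces_le_rank_special (d₁ d₂ : ℕ) (hd₁ : 1 ≤ d₁) (hd₂ : 1 ≤ d₂)
    (v w : Fin d₁ × Fin d₂ → ℂ) (hv : v ≠ 0) (hw : w ≠ 0)
    (C₂ : Matrix (Fin d₁ × Fin d₂) (Fin d₁ × Fin d₂) ℂ)
    (hnormal : C₂.conjTranspose * C₂ = C₂ * C₂.conjTranspose)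
    (hv0 : C₂.mulVec v = 0) (hw0 : C₂.mulVec w = 0)
    (C : Matrix (Fin d₁ × Fin d₂) (Fin d₁ × Fin d₂) ℂ)
    (hC : C = (Matrix.of fun p q => v p * (starRingEnd ℂ) (w q)) + C₂) :
    frobSq (ptr1 C) + frobSq (ptr2 C)
      ≤ (C.rank : ℝ) * frobSq C + (1 / (C.rank : ℝ)) * ‖C.trace‖ ^ 2 := by
  obtain ⟨τ, _, u, c, hc, hu, horth, rfl⟩ := exists_eq_sum_outer C₂ hnormal
  have huv := cdot_eq_zero_of_sum_outer_mulVec_eq_zero u c hc hu horth v hv0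
  have huw := cdot_eq_zero_of_sum_outer_mulVec_eq_zero u c hc hu horth w hw0
  have hvu : ∀ k, cdot v (u k) = 0 := fun k => by rw [← conj_cdot, huv, map_zero]
  have hwu : ∀ k, cdot w (u k) = 0 := fun k => by rw [← conj_cdot, huw, map_zero]
  refine sum_partial_traces_outer_le (τ := Option τ)
    (fun o => o.elim v fun k => c k • u k) (fun o => o.elim w u) ?_ ?_ ?_ ?_ ?_ ?_ C ?_
  · rintro (_ | k)
    exacts [hv, smul_ne_zero (hc k) (hu k)]
  · rintro (_ | k)
    exacts [hw, hu k]
  · rintro (_ | k) (_ | l) h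
    · exact absurd rfl h
    · simp [cdot_smul_right, hvu]
    · simp [cdot_smul_left, huv]
    · simp [cdot_smul_left, cdot_smul_right, horth k l fun e => h (congrArg some e)]
  · rintro (_ | k) (_ | l) h
    · exact absurd rfl h
    · exact hwu l
    · exact huw k
    · exact horth k l fun e => h (congrArg some e)
  · rintro (_ | k) (_ | l) h
    · exact absurd rfl h
    · simp [cdot_smul_right, hwu]
    · exact huv k
    · simp [cdot_smul_right, horth k l fun e => h (congrArg some e)]
  · rintro (_ | k) (_ | l) h
    · exact absurd rfl h
    · exact Or.inr ⟨c l, rfl⟩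
    · exact Or.inl ⟨c k, rfl⟩
    · exact Or.inl ⟨c k, rfl⟩
  · rw [hC, Fintype.sum_option]
    rfl
end

section
/- Let d₁, d₂, d₃ ≥ 1, let a, b : Fin d₁ × Fin d₂ × Fin d₃ → ℂ be nonzero vectors with ∑_p conj(a p)·b p = 0, and set C = a aᴴ − b bᴴ (so C is self-adjoint of rank 2 with one positive and one negative eigenvalue). Then ‖C‖₂² − (1/2)·(‖tr₁ C‖₂² + ‖tr₂ C‖₂² + ‖tr₃ C‖₂²) + (1/4)·(‖tr₁₂ C‖₂² + ‖tr₁₃ C‖₂² + ‖tr₂₃ C‖₂²) − (1/8)·|tr C|² ≥ 0. (This says q^(3)(−1/2, C) ≥ 0.) -/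
open Finset

/-- Partial trace over the first factor of a tripartite system. -/
noncomputable def tr1 {d₁ d₂ d₃ : ℕ} (C : Matrix (Fin d₁ × Fin d₂ × Fin d₃) (Fin d₁ × Fin d₂ × Fin d₃) ℂ) :
    Matrix (Fin d₂ × Fin d₃) (Fin d₂ × Fin d₃) ℂ :=
  Matrix.of fun p q => ∑ i, C (i, p.1, p.2) (i, q.1, q.2)

/-- Partial trace over the second factor of a tripartite system. -/
noncomputable def tr2 {d₁ d₂ d₃ : ℕ} (C : Matrix (Fin d₁ × Fin d₂ × Fin d₃) (Fin d₁ × Fin d₂ × Fin d₃) ℂ) :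
    Matrix (Fin d₁ × Fin d₃) (Fin d₁ × Fin d₃) ℂ :=
  Matrix.of fun p q => ∑ j, C (p.1, j, p.2) (q.1, j, q.2)

/-- Partial trace over the third factor of a tripartite system. -/
noncomputable def tr3 {d₁ d₂ d₃ : ℕ} (C : Matrix (Fin d₁ × Fin d₂ × Fin d₃) (Fin d₁ × Fin d₂ × Fin d₃) ℂ) :
    Matrix (Fin d₁ × Fin d₂) (Fin d₁ × Fin d₂) ℂ :=
  Matrix.of fun p q => ∑ k, C (p.1, p.2, k) (q.1, q.2, k)

/-- Partial trace over the first and second factors of a tripartite system. -/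
noncomputable def tr12 {d₁ d₂ d₃ : ℕ} (C : Matrix (Fin d₁ × Fin d₂ × Fin d₃) (Fin d₁ × Fin d₂ × Fin d₃) ℂ) :
    Matrix (Fin d₃) (Fin d₃) ℂ :=
  Matrix.of fun k k' => ∑ i, ∑ j, C (i, j, k) (i, j, k')

/-- Partial trace over the first and third factors of a tripartite system. -/
noncomputable def tr13 {d₁ d₂ d₃ : ℕ} (C : Matrix (Fin d₁ × Fin d₂ × Fin d₃) (Fin d₁ × Fin d₂ × Fin d₃) ℂ) :
    Matrix (Fin d₂) (Fin d₂) ℂ :=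
  Matrix.of fun j j' => ∑ i, ∑ k, C (i, j, k) (i, j', k)

/-- Partial trace over the second and third factors of a tripartite system. -/
noncomputable def tr23 {d₁ d₂ d₃ : ℕ} (C : Matrix (Fin d₁ × Fin d₂ × Fin d₃) (Fin d₁ × Fin d₂ × Fin d₃) ℂ) :
    Matrix (Fin d₁) (Fin d₁) ℂ :=
  Matrix.of fun i i' => ∑ j, ∑ k, C (i, j, k) (i', j, k)

open ComplexConjugate

section Involutions

variable {Z : Type*}

/-- Twice the antisymmetrization of `f` with respect to `e`. -/
def swapDiff (e : Z → Z) (f : Z → ℂ) : Z → ℂ := fun z => f z - f (e z)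

lemma swapDiff_apply_involutive {e : Z → Z} (he : Function.Involutive e) (f : Z → ℂ) (z : Z) :
    swapDiff e f (e z) = -swapDiff e f z := by
  simp [swapDiff, he z]

lemma swapDiff_comm {e e' : Z → Z} (h : ∀ z, e (e' z) = e' (e z)) (f : Z → ℂ) :
    swapDiff e (swapDiff e' f) = swapDiff e' (swapDiff e f) := by
  funext z
  simp only [swapDiff, h]
  ring

variable [Fintype Z]

/-- The real part of `⟨f, f ∘ e⟩`. -/
noncomputable def reOverlap (f : Z → ℂ) (e : Z → Z) : ℝ :=
  (∑ z, conj (f z) * f (e z)).re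

lemma reOverlap_id (f : Z → ℂ) : reOverlap f id = ∑ z, ‖f z‖ ^ 2 := by
  simp only [reOverlap, id, Complex.re_sum, Complex.conj_mul', ← Complex.ofReal_pow,
    Complex.ofReal_re]

lemma reOverlap_id_nonneg (f : Z → ℂ) : 0 ≤ reOverlap f id := by
  rw [reOverlap_id]
  positivity

lemma sum_conj_swapDiff_mul {e : Z → Z} (he : Function.Involutive e) (f g : Z → ℂ)
    (hg : ∀ z, g (e z) = -g z) :
    ∑ z, conj (swapDiff e f z) * g z = 2 * ∑ z, conj (f z) * g z := by
  have h : ∑ z, conj (f (e z)) * g z = -∑ z, conj (f z) * g z := by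
    rw [← Finset.sum_neg_distrib]
    refine Fintype.sum_equiv he.toPerm _ _ fun z => ?_
    simp [hg]
  simp only [swapDiff, map_sub, sub_mul, Finset.sum_sub_distrib, h]
  ring

lemma reOverlap_le {e : Z → Z} (he : Function.Involutive e) (f : Z → ℂ) :
    reOverlap f e ≤ reOverlap f id := by
  have h := sum_conj_swapDiff_mul he f (swapDiff e f) (swapDiff_apply_involutive he f)
  have h0 : 0 ≤ (∑ z, conj (swapDiff e f z) * swapDiff e f z).re :=
    reOverlap_id_nonneg (swapDiff e f)
  rw [h, Complex.mul_re, Complex.re_ofNat, Complex.im_ofNat, zero_mul, sub_zero] at h0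
  simp only [swapDiff, mul_sub, Finset.sum_sub_distrib, Complex.sub_re] at h0
  simp only [reOverlap, id]
  linarith

lemma reOverlap_alternating_nonneg {e₁ e₂ e₃ : Z → Z} (h₁ : Function.Involutive e₁)
    (h₂ : Function.Involutive e₂) (h₃ : Function.Involutive e₃)
    (h₁₂ : ∀ z, e₁ (e₂ z) = e₂ (e₁ z)) (h₁₃ : ∀ z, e₁ (e₃ z) = e₃ (e₁ z))
    (h₂₃ : ∀ z, e₂ (e₃ z) = e₃ (e₂ z)) (f : Z → ℂ) :
    0 ≤ reOverlap f id - (reOverlap f e₁ + reOverlap f e₂ + reOverlap f e₃)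
      + (reOverlap f (e₂ ∘ e₃) + reOverlap f (e₁ ∘ e₃) + reOverlap f (e₁ ∘ e₂))
      - reOverlap f (e₁ ∘ e₂ ∘ e₃) := by
  set T := swapDiff e₃ (swapDiff e₂ (swapDiff e₁ f)) with hT
  have a₃ : ∀ z, T (e₃ z) = -T z := swapDiff_apply_involutive h₃ _
  have a₂ : ∀ z, T (e₂ z) = -T z := by
    rw [hT, ← swapDiff_comm h₂₃]
    exact swapDiff_apply_involutive h₂ _
  have a₁ : ∀ z, T (e₁ z) = -T z := by
    rw [hT, ← swapDiff_comm h₁₂, ← swapDiff_comm h₁₃]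
    exact swapDiff_apply_involutive h₁ _
  have h : ∑ z, conj (T z) * T z = 8 * ∑ z, conj (f z) * T z := by
    conv_lhs => enter [2, z, 1]; rw [hT]
    rw [sum_conj_swapDiff_mul h₃ _ _ a₃, sum_conj_swapDiff_mul h₂ _ _ a₂,
      sum_conj_swapDiff_mul h₁ _ _ a₁]
    ring
  have h0 : 0 ≤ (∑ z, conj (T z) * T z).re := reOverlap_id_nonneg T
  rw [h, Complex.mul_re, Complex.re_ofNat, Complex.im_ofNat, zero_mul, sub_zero] at h0
  simp only [hT, swapDiff, mul_sub, Finset.sum_sub_distrib, Complex.sub_re] at h0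
  simp only [reOverlap, id, Function.comp_apply]
  linarith

end Involutions

section Bipartite

variable {m n : Type*} [Fintype m] [Fintype n]

/-- The real part of `tr (ρ_x ρ_y)`, where `ρ_x` is the reduction of `x xᴴ` to the second factor. -/
noncomputable def reducedOverlap (x y : m → n → ℂ) : ℝ :=
  ∑ r, ∑ s, ((∑ p, x p r * conj (x p s)) * conj (∑ q, y q r * conj (y q s))).re

lemma sum_norm_sq_reduced_sub (x y : m → n → ℂ) :
    ∑ r, ∑ s, ‖∑ p, (x p r * conj (x p s) - y p r * conj (y p s))‖ ^ 2 =
      reducedOverlap x x + reducedOverlap y y - 2 * reducedOverlap x y := by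
  simp only [reducedOverlap, Finset.mul_sum, ← Finset.sum_add_distrib, ← Finset.sum_sub_distrib]
  refine Finset.sum_congr rfl fun r _ => Finset.sum_congr rfl fun s _ => ?_
  rw [Finset.sum_sub_distrib, ← Complex.normSq_eq_norm_sq, Complex.normSq_sub, Complex.mul_conj,
    Complex.mul_conj, Complex.ofReal_re, Complex.ofReal_re]

lemma reducedOverlap_eq (x y : m → n → ℂ) :
    reducedOverlap x y = (∑ w : (n × n) × (m × m),
      conj (x w.2.1 w.1.2 * y w.2.2 w.1.1) * (x w.2.1 w.1.1 * y w.2.2 w.1.2)).re := by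
  simp only [reducedOverlap, Fintype.sum_prod_type, Complex.re_sum, map_sum, Finset.sum_mul_sum]
  refine Finset.sum_congr rfl fun r _ => Finset.sum_congr rfl fun s _ =>
    Finset.sum_congr rfl fun p _ => Finset.sum_congr rfl fun q _ => ?_
  congr 1
  simp only [map_mul, Complex.conj_conj]
  ring

lemma reducedOverlap_nonneg (x y : m → n → ℂ) : 0 ≤ reducedOverlap x y := by
  have h : reducedOverlap x y = ∑ p, ∑ q, ‖∑ r, x p r * conj (y q r)‖ ^ 2 := by
    rw [reducedOverlap_eq, ← Complex.ofReal_re (∑ p, ∑ q, _)]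
    congr 1
    push_cast
    simp only [← Complex.mul_conj', map_sum, Finset.sum_mul_sum]
    rw [Fintype.sum_prod_type_right, Fintype.sum_prod_type]
    refine Finset.sum_congr rfl fun p _ => Finset.sum_congr rfl fun q _ => ?_
    rw [Fintype.sum_prod_type]
    refine Finset.sum_congr rfl fun r _ => Finset.sum_congr rfl fun s _ => ?_
    simp only [map_mul, Complex.conj_conj]
    ring
  rw [h]
  positivity

end Bipartite

section Tripartite

variable {ι κ μ : Type*}

/-- Exchange the first components of two triples. -/
def swapFst (z : (ι × κ × μ) × (ι × κ × μ)) : (ι × κ × μ) × (ι × κ × μ) :=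
  ((z.2.1, z.1.2.1, z.1.2.2), (z.1.1, z.2.2.1, z.2.2.2))

/-- Exchange the second components of two triples. -/
def swapSnd (z : (ι × κ × μ) × (ι × κ × μ)) : (ι × κ × μ) × (ι × κ × μ) :=
  ((z.1.1, z.2.2.1, z.1.2.2), (z.2.1, z.1.2.1, z.2.2.2))

/-- Exchange the third components of two triples. -/
def swapThd (z : (ι × κ × μ) × (ι × κ × μ)) : (ι × κ × μ) × (ι × κ × μ) :=
  ((z.1.1, z.1.2.1, z.2.2.2), (z.2.1, z.2.2.1, z.1.2.2))

/-- The tensor product of two vectors. -/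
def tensorFun {D : Type*} (a b : D → ℂ) (z : D × D) : ℂ := a z.1 * b z.2

variable [Fintype ι] [Fintype κ] [Fintype μ]

lemma reducedOverlap_traceFst (a b : ι × κ × μ → ℂ) :
    reducedOverlap (fun (p : ι) (r : κ × μ) => a (p, r.1, r.2))
        (fun p r => b (p, r.1, r.2)) =
      reOverlap (tensorFun a b) (swapSnd ∘ swapThd) := by
  rw [reducedOverlap_eq, reOverlap]
  congr 1
  exact Fintype.sum_equiv
    ⟨fun w => ((w.2.1, w.1.2.1, w.1.2.2), (w.2.2, w.1.1.1, w.1.1.2)),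
      fun z => (((z.2.2.1, z.2.2.2), (z.1.2.1, z.1.2.2)), (z.1.1, z.2.1)),
      fun _ => rfl, fun _ => rfl⟩ _ _ fun _ => rfl

lemma reducedOverlap_traceSnd (a b : ι × κ × μ → ℂ) :
    reducedOverlap (fun (p : κ) (r : ι × μ) => a (r.1, p, r.2))
        (fun p r => b (r.1, p, r.2)) =
      reOverlap (tensorFun a b) (swapFst ∘ swapThd) := by
  rw [reducedOverlap_eq, reOverlap]
  congr 1
  exact Fintype.sum_equiv
    ⟨fun w => ((w.1.2.1, w.2.1, w.1.2.2), (w.1.1.1, w.2.2, w.1.1.2)),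
      fun z => (((z.2.1, z.2.2.2), (z.1.1, z.1.2.2)), (z.1.2.1, z.2.2.1)),
      fun _ => rfl, fun _ => rfl⟩ _ _ fun _ => rfl

lemma reducedOverlap_traceThd (a b : ι × κ × μ → ℂ) :
    reducedOverlap (fun (p : μ) (r : ι × κ) => a (r.1, r.2, p))
        (fun p r => b (r.1, r.2, p)) =
      reOverlap (tensorFun a b) (swapFst ∘ swapSnd) := by
  rw [reducedOverlap_eq, reOverlap]
  congr 1
  exact Fintype.sum_equiv
    ⟨fun w => ((w.1.2.1, w.1.2.2, w.2.1), (w.1.1.1, w.1.1.2, w.2.2)),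
      fun z => (((z.2.1, z.2.2.1), (z.1.1, z.1.2.1)), (z.1.2.2, z.2.2.2)),
      fun _ => rfl, fun _ => rfl⟩ _ _ fun _ => rfl

lemma reducedOverlap_keepThd (a b : ι × κ × μ → ℂ) :
    reducedOverlap (fun (p : ι × κ) (r : μ) => a (p.1, p.2, r))
        (fun p r => b (p.1, p.2, r)) =
      reOverlap (tensorFun a b) (swapThd) := by
  rw [reducedOverlap_eq, reOverlap]
  congr 1
  exact Fintype.sum_equiv
    ⟨fun w => ((w.2.1.1, w.2.1.2, w.1.2), (w.2.2.1, w.2.2.2, w.1.1)),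
      fun z => ((z.2.2.2, z.1.2.2), ((z.1.1, z.1.2.1), (z.2.1, z.2.2.1))),
      fun _ => rfl, fun _ => rfl⟩ _ _ fun _ => rfl

lemma reducedOverlap_keepSnd (a b : ι × κ × μ → ℂ) :
    reducedOverlap (fun (p : ι × μ) (r : κ) => a (p.1, r, p.2))
        (fun p r => b (p.1, r, p.2)) =
      reOverlap (tensorFun a b) (swapSnd) := by
  rw [reducedOverlap_eq, reOverlap]
  congr 1
  exact Fintype.sum_equiv
    ⟨fun w => ((w.2.1.1, w.1.2, w.2.1.2), (w.2.2.1, w.1.1, w.2.2.2)),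
      fun z => ((z.2.2.1, z.1.2.1), ((z.1.1, z.1.2.2), (z.2.1, z.2.2.2))),
      fun _ => rfl, fun _ => rfl⟩ _ _ fun _ => rfl

lemma reducedOverlap_keepFst (a b : ι × κ × μ → ℂ) :
    reducedOverlap (fun (p : κ × μ) (r : ι) => a (r, p.1, p.2))
        (fun p r => b (r, p.1, p.2)) =
      reOverlap (tensorFun a b) (swapFst) := by
  rw [reducedOverlap_eq, reOverlap]
  congr 1
  exact Fintype.sum_equiv
    ⟨fun w => ((w.1.2, w.2.1.1, w.2.1.2), (w.1.1, w.2.2.1, w.2.2.2)),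
      fun z => ((z.2.1, z.1.1), ((z.1.2.1, z.1.2.2), (z.2.2.1, z.2.2.2))),
      fun _ => rfl, fun _ => rfl⟩ _ _ fun _ => rfl

lemma reducedOverlap_traceNone (a b : ι × κ × μ → ℂ) :
    reducedOverlap (fun (_ : Unit) (r : ι × κ × μ) => a (r.1, r.2.1, r.2.2))
        (fun _ r => b (r.1, r.2.1, r.2.2)) =
      reOverlap (tensorFun a b) (swapFst ∘ swapSnd ∘ swapThd) := by
  rw [reducedOverlap_eq, reOverlap]
  congr 1
  exact Fintype.sum_equiv
    ⟨fun w => ((w.1.2.1, w.1.2.2.1, w.1.2.2.2), (w.1.1.1, w.1.1.2.1, w.1.1.2.2)),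
      fun z => (((z.2.1, z.2.2.1, z.2.2.2), (z.1.1, z.1.2.1, z.1.2.2)), ((), ())),
      fun _ => rfl, fun _ => rfl⟩ _ _ fun _ => rfl

lemma reOverlap_tensorFun_id {D : Type*} [Fintype D] (a b : D → ℂ) :
    reOverlap (tensorFun a b) id = (∑ p, ‖a p‖ ^ 2) * ∑ p, ‖b p‖ ^ 2 := by
  simp only [reOverlap_id, tensorFun, Fintype.sum_prod_type, norm_mul, mul_pow,
    Finset.sum_mul_sum]

lemma reOverlap_tensorFun_swap {D : Type*} [Fintype D] (a b : D → ℂ)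
    (hab : ∑ p, conj (a p) * b p = 0) :
    reOverlap (tensorFun a b) Prod.swap = 0 := by
  have h : ∑ z, conj (tensorFun a b z) * tensorFun a b z.swap =
      (∑ p, conj (a p) * b p) * ∑ q, conj (b q) * a q := by
    simp only [tensorFun, Fintype.sum_prod_type, Finset.sum_mul_sum, Prod.fst_swap,
      Prod.snd_swap, map_mul]
    refine Finset.sum_congr rfl fun p _ => Finset.sum_congr rfl fun q _ => ?_
    ring
  simp [reOverlap, h, hab]

lemma reOverlap_tensorFun_self_swap {D : Type*} [Fintype D] (a : D → ℂ) (e : D × D → D × D) :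
    reOverlap (tensorFun a a) (Prod.swap ∘ e) = reOverlap (tensorFun a a) e := by
  simp only [reOverlap, tensorFun, Function.comp_apply, Prod.fst_swap, Prod.snd_swap, mul_comm]

end Tripartite

/-- For a self-adjoint rank-2 matrix `C = a aᴴ − b bᴴ` (with `a ⊥ b` both nonzero),
the tripartite form `q^(3)(-1/2, C)` is nonnegative. -/
theorem q3_at_neg_half_nonneg (d₁ d₂ d₃ : ℕ) (h₁ : 1 ≤ d₁) (h₂ : 1 ≤ d₂) (h₃ : 1 ≤ d₃)
    (a b : Fin d₁ × Fin d₂ × Fin d₃ → ℂ) (ha : a ≠ 0) (hb : b ≠ 0)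
    (hab : ∑ p, (starRingEnd ℂ) (a p) * b p = 0)
    (C : Matrix (Fin d₁ × Fin d₂ × Fin d₃) (Fin d₁ × Fin d₂ × Fin d₃) ℂ)
    (hC : C = Matrix.of fun p q =>
      a p * (starRingEnd ℂ) (a q) - b p * (starRingEnd ℂ) (b q)) :
    0 ≤ frobSq C - (1 / 2) * (frobSq (tr1 C) + frobSq (tr2 C) + frobSq (tr3 C))
        + (1 / 4) * (frobSq (tr12 C) + frobSq (tr13 C) + frobSq (tr23 C))
        - (1 / 8) * ‖C.trace‖ ^ 2 := by
  have hsplit : ∀ {m n : Type} [Fintype m] [Fintype n]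
      (t : m → n → Fin d₁ × Fin d₂ × Fin d₃),
      ∑ r, ∑ s, ‖∑ p, C (t p r) (t p s)‖ ^ 2 =
        reducedOverlap (fun p r => a (t p r)) (fun p r => a (t p r)) +
          reducedOverlap (fun p r => b (t p r)) (fun p r => b (t p r)) -
          2 * reducedOverlap (fun p r => a (t p r)) (fun p r => b (t p r)) := by
    intro m n _ _ t
    rw [← sum_norm_sq_reduced_sub, hC]
    rfl
  have e1 := hsplit fun (p : Fin d₁) (r : Fin d₂ × Fin d₃) => (p, r.1, r.2)
  have e2 := hsplit fun (p : Fin d₂) (r : Fin d₁ × Fin d₃) => (r.1, p, r.2)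
  have e3 := hsplit fun (p : Fin d₃) (r : Fin d₁ × Fin d₂) => (r.1, r.2, p)
  have e12 := hsplit fun (p : Fin d₁ × Fin d₂) (r : Fin d₃) => (p.1, p.2, r)
  have e13 := hsplit fun (p : Fin d₁ × Fin d₃) (r : Fin d₂) => (p.1, r, p.2)
  have e23 := hsplit fun (p : Fin d₂ × Fin d₃) (r : Fin d₁) => (r, p.1, p.2)
  have e0 := hsplit fun (_ : Unit) (r : Fin d₁ × Fin d₂ × Fin d₃) => (r.1, r.2.1, r.2.2)
  simp only [reducedOverlap_traceFst] at e1
  simp only [reducedOverlap_traceSnd] at e2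
  simp only [reducedOverlap_traceThd] at e3
  simp only [reducedOverlap_keepThd, Fintype.sum_prod_type] at e12
  simp only [reducedOverlap_keepSnd, Fintype.sum_prod_type] at e13
  simp only [reducedOverlap_keepFst, Fintype.sum_prod_type] at e23
  simp only [reducedOverlap_traceNone, Finset.univ_unique, Finset.sum_singleton] at e0
  rw [show frobSq C = _ from e0, show frobSq (tr1 C) = _ from e1, show frobSq (tr2 C) = _ from e2,
    show frobSq (tr3 C) = _ from e3, show frobSq (tr12 C) = _ from e12,
    show frobSq (tr13 C) = _ from e13, show frobSq (tr23 C) = _ from e23]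
  have htr : ‖C.trace‖ ^ 2 = (∑ p, ‖a p‖ ^ 2 - ∑ p, ‖b p‖ ^ 2) ^ 2 := by
    have : C.trace = ((∑ p, ‖a p‖ ^ 2 - ∑ p, ‖b p‖ ^ 2 : ℝ) : ℂ) := by
      rw [hC]
      simp [Matrix.trace, Complex.mul_conj']
    rw [this, Complex.norm_real, Real.norm_eq_abs, sq_abs]
  have i₁ : Function.Involutive (swapFst (ι := Fin d₁) (κ := Fin d₂) (μ := Fin d₃)) := fun _ => rfl
  have i₂ : Function.Involutive (swapSnd (ι := Fin d₁) (κ := Fin d₂) (μ := Fin d₃)) := fun _ => rfl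
  have i₃ : Function.Involutive (swapThd (ι := Fin d₁) (κ := Fin d₂) (μ := Fin d₃)) := fun _ => rfl
  have hanti := reOverlap_alternating_nonneg i₁ i₂ i₃ (fun _ => rfl) (fun _ => rfl) (fun _ => rfl)
    (tensorFun a b)
  have hself : ∀ x : Fin d₁ × Fin d₂ × Fin d₃ → ℂ,
      reOverlap (tensorFun x x) (swapSnd ∘ swapThd) = reOverlap (tensorFun x x) swapFst ∧
      reOverlap (tensorFun x x) (swapFst ∘ swapThd) = reOverlap (tensorFun x x) swapSnd ∧
      reOverlap (tensorFun x x) (swapFst ∘ swapSnd) = reOverlap (tensorFun x x) swapThd ∧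
      reOverlap (tensorFun x x) (swapFst ∘ swapSnd ∘ swapThd) = (∑ p, ‖x p‖ ^ 2) ^ 2 ∧
      reOverlap (tensorFun x x) swapFst ≤ (∑ p, ‖x p‖ ^ 2) ^ 2 ∧
      reOverlap (tensorFun x x) swapSnd ≤ (∑ p, ‖x p‖ ^ 2) ^ 2 ∧
      reOverlap (tensorFun x x) swapThd ≤ (∑ p, ‖x p‖ ^ 2) ^ 2 := by
    intro x
    have hid : (∑ p, ‖x p‖ ^ 2) ^ 2 = reOverlap (tensorFun x x) id := by
      rw [reOverlap_tensorFun_id, sq]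
    rw [hid]
    exact ⟨reOverlap_tensorFun_self_swap x swapFst, reOverlap_tensorFun_self_swap x swapSnd,
      reOverlap_tensorFun_self_swap x swapThd, reOverlap_tensorFun_self_swap x id,
      reOverlap_le i₁ _, reOverlap_le i₂ _, reOverlap_le i₃ _⟩
  obtain ⟨a₁, a₂, a₃, a₀, la₁, la₂, la₃⟩ := hself a
  obtain ⟨b₁, b₂, b₃, b₀, lb₁, lb₂, lb₃⟩ := hself b
  have horth : reOverlap (tensorFun a b) (swapFst ∘ swapSnd ∘ swapThd) = 0 :=
    reOverlap_tensorFun_swap a b hab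
  have u₁ : 0 ≤ reOverlap (tensorFun a b) (swapSnd ∘ swapThd) :=
    reducedOverlap_traceFst a b ▸ reducedOverlap_nonneg _ _
  have u₂ : 0 ≤ reOverlap (tensorFun a b) (swapFst ∘ swapThd) :=
    reducedOverlap_traceSnd a b ▸ reducedOverlap_nonneg _ _
  have u₃ : 0 ≤ reOverlap (tensorFun a b) (swapFst ∘ swapSnd) :=
    reducedOverlap_traceThd a b ▸ reducedOverlap_nonneg _ _
  rw [reOverlap_tensorFun_id, horth] at hanti
  rw [a₁, a₂, a₃, a₀, b₁, b₂, b₃, b₀, horth, htr]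
  nlinarith [sq_nonneg (∑ p, ‖a p‖ ^ 2 - ∑ p, ‖b p‖ ^ 2)]
end

section
/- Let d₁, d₂, d₃ ≥ 1 and let C : Matrix (Fin d₁ × Fin d₂ × Fin d₃) (Fin d₁ × Fin d₂ × Fin d₃) ℂ be a nonzero positive semidefinite matrix of rank r. Then ‖C‖₂² + (1/r)·(‖tr₁ C‖₂² + ‖tr₂ C‖₂² − ‖tr₃ C‖₂²) + (1/r²)·(‖tr₁₂ C‖₂² − ‖tr₁₃ C‖₂² − ‖tr₂₃ C‖₂²) − (1/r³)·|tr C|² ≥ 0. (This is the positivity of the tripartite form q_{(0,0,1)} at parameter −1/r for positive semidefinite matrices.) -/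
open Finset ComplexOrder

open scoped ComplexConjugate

section Gram

variable {α β σ : Type*}

/-- Entries of the Gram matrix `V * Vᴴ` of a tensor `V` with row index in `α × β`. -/
noncomputable def gramEntry [Fintype σ] (V : α → β → σ → ℂ) (a : α) (b : β) (a' : α) (b' : β) : ℂ :=
  ∑ s, V a b s * conj (V a' b' s)

lemma conj_gramEntry [Fintype σ] (V : α → β → σ → ℂ) (a : α) (b : β) (a' : α) (b' : β) :
    conj (gramEntry V a b a' b') = gramEntry V a' b' a b := by
  simp [gramEntry, mul_comm]

lemma gramEntry_mul_gramEntry [Fintype σ] (V : α → β → σ → ℂ) (a b a' b' c d c' d') :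
    gramEntry V a b a' b' * gramEntry V c d c' d' =
      ∑ s, ∑ t, V a b s * V c d t * conj (V a' b' s * V c' d' t) := by
  simp only [gramEntry, sum_mul_sum, map_mul]
  refine Finset.sum_congr rfl fun s _ => Finset.sum_congr rfl fun t _ => ?_
  ring

variable [Fintype α] [Fintype β] [Fintype σ]

lemma ofReal_sum_normSq_gram (M : β → σ → ℂ) :
    ((∑ b, ∑ b', ‖∑ s, M b s * conj (M b' s)‖ ^ 2 : ℝ) : ℂ) =
      ∑ b, ∑ b', ∑ s, ∑ s', M b s * conj (M b' s) * (conj (M b s') * M b' s') := by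
  push_cast
  refine Finset.sum_congr rfl fun b _ => Finset.sum_congr rfl fun b' _ => ?_
  rw [← Complex.mul_conj', map_sum, sum_mul_sum]
  simp

/-- A matrix `M` satisfies `‖M * Mᴴ‖₂ = ‖Mᴴ * M‖₂`. -/
lemma sum_normSq_gram_comm (M : β → σ → ℂ) :
    ∑ b, ∑ b', ‖∑ s, M b s * conj (M b' s)‖ ^ 2 =
      ∑ s, ∑ s', ‖∑ b, M b s * conj (M b s')‖ ^ 2 := by
  rw [← Complex.ofReal_inj, ofReal_sum_normSq_gram, ofReal_sum_normSq_gram fun s b => M b s]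
  simp only [sum_comm (s := (univ : Finset β)) (t := (univ : Finset σ))]
  refine Finset.sum_congr rfl fun s _ => Finset.sum_congr rfl fun s' _ =>
    Finset.sum_congr rfl fun b _ => Finset.sum_congr rfl fun b' _ => ?_
  ring

/-- The reduction criterion in Hilbert–Schmidt form. -/
lemma sum_normSq_trace_snd_le (V : α → β → σ → ℂ) :
    ∑ a, ∑ a', ‖∑ b, gramEntry V a b a' b‖ ^ 2 ≤
      Fintype.card σ * ∑ b, ∑ b', ‖∑ a, gramEntry V a b a b'‖ ^ 2 := by
  have hB : ∑ b, ∑ b', ‖∑ a, gramEntry V a b a b'‖ ^ 2 =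
      ∑ x : α × σ, ∑ y : α × σ, ‖∑ b, V x.1 b x.2 * conj (V y.1 b y.2)‖ ^ 2 := by
    rw [← sum_normSq_gram_comm fun b (x : α × σ) => V x.1 b x.2]
    simp only [gramEntry, Fintype.sum_prod_type]
  have hdiag : ∑ a, ∑ a', ∑ s, ‖∑ b, V a b s * conj (V a' b s)‖ ^ 2 ≤
      ∑ x : α × σ, ∑ y : α × σ, ‖∑ b, V x.1 b x.2 * conj (V y.1 b y.2)‖ ^ 2 := by
    simp only [Fintype.sum_prod_type]
    refine sum_le_sum fun a _ => ?_
    rw [sum_comm]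
    simp only [sum_comm (s := (univ : Finset α)) (t := (univ : Finset σ))]
    exact sum_le_sum fun s _ => single_le_sum
      (f := fun s' => ∑ a', ‖∑ b, V a b s * conj (V a' b s')‖ ^ 2)
      (fun _ _ => by positivity) (mem_univ s)
  rw [hB]
  refine le_trans ?_ (mul_le_mul_of_nonneg_left hdiag (Nat.cast_nonneg _))
  simp only [mul_sum (s := (univ : Finset α))]
  refine sum_le_sum fun a _ => sum_le_sum fun a' _ => ?_
  simp only [gramEntry]
  rw [sum_comm]
  refine le_trans (pow_le_pow_left₀ (norm_nonneg _) (norm_sum_le _ _) 2) ?_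
  simpa using sq_sum_le_card_mul_sum_sq (s := (univ : Finset σ))
    (f := fun s => ‖∑ b, V a b s * conj (V a' b s)‖)

/-- For the swaps `F` on the two factors, `1 - F_α ± F_β (1 - F_α)` is nonnegative on `C ⊗ C`. -/
lemma abs_sum_normSq_sub_le (V : α → β → σ → ℂ) :
    |∑ b, ∑ b', ‖∑ a, gramEntry V a b a b'‖ ^ 2 -
        ∑ a, ∑ b, ∑ a', ∑ b', ‖gramEntry V a b a' b'‖ ^ 2| ≤
      ‖∑ a, ∑ b, gramEntry V a b a b‖ ^ 2 -
        ∑ a, ∑ a', ‖∑ b, gramEntry V a b a' b‖ ^ 2 := by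
  set D : α → β → α → β → σ → σ → ℂ := fun a b a' b' s t =>
    V a b s * V a' b' t - V a' b s * V a b' t with hD
  have swap : ∀ f : α → β → α → β → ℂ,
      ∑ a, ∑ b, ∑ a', ∑ b', f a' b a b' = ∑ a, ∑ b, ∑ a', ∑ b', f a b a' b' := by
    intro f
    rw [sum_comm]
    conv_rhs => rw [sum_comm]
    exact Finset.sum_congr rfl fun _ _ => sum_comm
  have h0 : ((‖∑ a, ∑ b, gramEntry V a b a b‖ ^ 2 : ℝ) : ℂ) =
      ∑ a, ∑ b, ∑ a', ∑ b', gramEntry V a b a b * gramEntry V a' b' a' b' := by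
    push_cast
    rw [← Complex.mul_conj']
    simp only [map_sum, conj_gramEntry, mul_sum, sum_mul]
    refine Finset.sum_congr rfl fun a _ => Finset.sum_congr rfl fun b _ =>
      Finset.sum_congr rfl fun a' _ => Finset.sum_congr rfl fun b' _ => mul_comm _ _
  have hα : ((∑ a, ∑ a', ‖∑ b, gramEntry V a b a' b‖ ^ 2 : ℝ) : ℂ) =
      ∑ a, ∑ b, ∑ a', ∑ b', gramEntry V a b a' b * gramEntry V a' b' a b' := by
    push_cast
    refine Finset.sum_congr rfl fun a _ => ?_
    rw [sum_comm (s := (univ : Finset β))]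
    refine Finset.sum_congr rfl fun a' _ => ?_
    rw [← Complex.mul_conj', map_sum, sum_mul_sum]
    simp only [conj_gramEntry]
  have hβ : ((∑ b, ∑ b', ‖∑ a, gramEntry V a b a b'‖ ^ 2 : ℝ) : ℂ) =
      ∑ a, ∑ b, ∑ a', ∑ b', gramEntry V a b a b' * gramEntry V a' b' a' b := by
    push_cast
    rw [sum_comm (s := (univ : Finset α))]
    refine Finset.sum_congr rfl fun b _ => ?_
    simp only [sum_comm (s := (univ : Finset α)) (t := (univ : Finset β))]
    refine Finset.sum_congr rfl fun b' _ => ?_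
    rw [← Complex.mul_conj', map_sum, sum_mul_sum]
    simp only [conj_gramEntry]
  have hαβ : ((∑ a, ∑ b, ∑ a', ∑ b', ‖gramEntry V a b a' b'‖ ^ 2 : ℝ) : ℂ) =
      ∑ a, ∑ b, ∑ a', ∑ b', gramEntry V a b a' b' * gramEntry V a' b' a b := by
    push_cast
    simp only [← Complex.mul_conj', conj_gramEntry]
  have hX : ∑ a, ∑ b, ∑ a', ∑ b', ∑ s, ∑ t, ‖D a b a' b' s t‖ ^ 2 =
      2 * (‖∑ a, ∑ b, gramEntry V a b a b‖ ^ 2 -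
        ∑ a, ∑ a', ‖∑ b, gramEntry V a b a' b‖ ^ 2) := by
    have hpt : ∀ a b a' b', ∑ s, ∑ t, D a b a' b' s t * conj (D a b a' b' s t) =
        gramEntry V a b a b * gramEntry V a' b' a' b' -
        gramEntry V a b a' b * gramEntry V a' b' a b' -
        gramEntry V a' b a b * gramEntry V a b' a' b' +
        gramEntry V a' b a' b * gramEntry V a b' a b' := by
      intro a b a' b'
      simp only [gramEntry_mul_gramEntry, ← sum_sub_distrib, ← sum_add_distrib, hD]
      refine Finset.sum_congr rfl fun s _ => Finset.sum_congr rfl fun t _ => ?_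
      simp only [map_sub]
      ring
    rw [← Complex.ofReal_inj, Complex.ofReal_mul, Complex.ofReal_sub, h0, hα]
    push_cast
    simp only [← Complex.mul_conj', hpt, sum_add_distrib, sum_sub_distrib]
    rw [swap fun a b a' b' => gramEntry V a b a' b * gramEntry V a' b' a b',
      swap fun a b a' b' => gramEntry V a b a b * gramEntry V a' b' a' b']
    ring
  have hY : ∑ a, ∑ b, ∑ a', ∑ b', ∑ s, ∑ t, (D a b a' b' s t * conj (D a b' a' b s t)).re =
      2 * (∑ b, ∑ b', ‖∑ a, gramEntry V a b a b'‖ ^ 2 -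
        ∑ a, ∑ b, ∑ a', ∑ b', ‖gramEntry V a b a' b'‖ ^ 2) := by
    have hpt : ∀ a b a' b', ∑ s, ∑ t, D a b a' b' s t * conj (D a b' a' b s t) =
        gramEntry V a b a b' * gramEntry V a' b' a' b -
        gramEntry V a b a' b' * gramEntry V a' b' a b -
        gramEntry V a' b a b' * gramEntry V a b' a' b +
        gramEntry V a' b a' b' * gramEntry V a b' a b := by
      intro a b a' b'
      simp only [gramEntry_mul_gramEntry, ← sum_sub_distrib, ← sum_add_distrib, hD]
      refine Finset.sum_congr rfl fun s _ => Finset.sum_congr rfl fun t _ => ?_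
      simp only [map_sub]
      ring
    simp only [← Complex.re_sum]
    rw [← Complex.ofReal_re (2 * _), Complex.ofReal_mul, Complex.ofReal_sub, hβ, hαβ]
    congr 1
    simp only [hpt, sum_add_distrib, sum_sub_distrib]
    rw [swap fun a b a' b' => gramEntry V a b a' b' * gramEntry V a' b' a b,
      swap fun a b a' b' => gramEntry V a b a b' * gramEntry V a' b' a' b]
    push_cast
    ring
  have hX' : ∑ a, ∑ b, ∑ a', ∑ b', ∑ s, ∑ t, ‖D a b' a' b s t‖ ^ 2 =
      ∑ a, ∑ b, ∑ a', ∑ b', ∑ s, ∑ t, ‖D a b a' b' s t‖ ^ 2 := by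
    refine Finset.sum_congr rfl fun a _ => ?_
    rw [sum_comm]
    conv_rhs => rw [sum_comm]
    exact Finset.sum_congr rfl fun _ _ => sum_comm
  have hYX : |∑ a, ∑ b, ∑ a', ∑ b', ∑ s, ∑ t, (D a b a' b' s t * conj (D a b' a' b s t)).re| ≤
      ∑ a, ∑ b, ∑ a', ∑ b', ∑ s, ∑ t, (‖D a b a' b' s t‖ ^ 2 + ‖D a b' a' b s t‖ ^ 2) / 2 := by
    refine (abs_sum_le_sum_abs _ _).trans (sum_le_sum fun a _ => ?_)
    refine (abs_sum_le_sum_abs _ _).trans (sum_le_sum fun b _ => ?_)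
    refine (abs_sum_le_sum_abs _ _).trans (sum_le_sum fun a' _ => ?_)
    refine (abs_sum_le_sum_abs _ _).trans (sum_le_sum fun b' _ => ?_)
    refine (abs_sum_le_sum_abs _ _).trans (sum_le_sum fun s _ => ?_)
    refine (abs_sum_le_sum_abs _ _).trans (sum_le_sum fun t _ => ?_)
    refine (Complex.abs_re_le_norm _).trans ?_
    rw [norm_mul, Complex.norm_conj]
    linarith [two_mul_le_add_sq ‖D a b a' b' s t‖ ‖D a b' a' b s t‖]
  simp only [← sum_div, sum_add_distrib] at hYX
  rw [hX', hX, hY, abs_mul, abs_two] at hYX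
  linarith

end Gram

/-- A positive semidefinite matrix is a Gram matrix with as many columns as its rank. -/
lemma Matrix.PosSemidef.exists_gram {n : Type*} [Fintype n] {C : Matrix n n ℂ}
    (hC : C.PosSemidef) :
    ∃ V : n → Fin C.rank → ℂ, ∀ x y, C x y = ∑ s, V x s * conj (V y s) := by
  classical
  have hcard := hC.isHermitian.rank_eq_card_non_zero_eigs
  let e : Fin C.rank ≃ {i // hC.isHermitian.eigenvalues i ≠ 0} :=
    (Fintype.equivFinOfCardEq hcard.symm).symm
  set U : Matrix n n ℂ := hC.isHermitian.eigenvectorUnitary.1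
  refine ⟨fun x s => U x (e s) * (√(hC.isHermitian.eigenvalues (e s)) : ℝ), fun x y => ?_⟩
  have h : C x y = ∑ i, U x i * (hC.isHermitian.eigenvalues i : ℂ) * conj (U y i) := by
    conv_lhs => rw [hC.isHermitian.spectral_theorem]
    simp [Unitary.conjStarAlgAut_apply, Matrix.mul_apply, Matrix.diagonal_apply, U]
  have hsub : ∑ i : {i // hC.isHermitian.eigenvalues i ≠ 0},
      U x i * (hC.isHermitian.eigenvalues i : ℂ) * conj (U y i) =
        ∑ i, U x i * (hC.isHermitian.eigenvalues i : ℂ) * conj (U y i) := by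
    rw [← Finset.sum_subtype (univ.filter fun i => hC.isHermitian.eigenvalues i ≠ 0) (by simp)
      fun i => U x i * (hC.isHermitian.eigenvalues i : ℂ) * conj (U y i)]
    refine Finset.sum_filter_of_ne fun i _ hi h0 => hi ?_
    simp [h0]
  rw [h, ← hsub, ← e.sum_comp]
  refine Finset.sum_congr rfl fun s _ => ?_
  have hs : ((√(hC.isHermitian.eigenvalues (e s)) : ℝ) : ℂ) *
      (√(hC.isHermitian.eigenvalues (e s)) : ℝ) = (hC.isHermitian.eigenvalues (e s) : ℂ) := by
    rw [← Complex.ofReal_mul, Real.mul_self_sqrt (hC.eigenvalues_nonneg _)]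
  rw [map_mul, Complex.conj_ofReal, ← hs]
  ring

lemma nonneg_of_trace_bounds {r t t₀ a₁ a₂ a₃ b₁₂ b₁₃ b₂₃ : ℝ} (hr : 1 ≤ r)
    (h₂₃ : b₂₃ ≤ r * a₁) (h₁₃ : b₁₃ ≤ r * a₂) (h : t₀ ≤ r * t)
    (hlo : -(t₀ - a₃) ≤ b₁₂ - t) (hhi : b₁₂ - t ≤ t₀ - a₃) :
    0 ≤ t + 1 / r * (a₁ + a₂ - a₃) + 1 / r ^ 2 * (b₁₂ - b₁₃ - b₂₃) - 1 / r ^ 3 * t₀ := by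
  have hr0 : 0 < r := by linarith
  have key : t + 1 / r * (a₁ + a₂ - a₃) + 1 / r ^ 2 * (b₁₂ - b₁₃ - b₂₃) - 1 / r ^ 3 * t₀ =
      (r * (r * a₁ - b₂₃) + r * (r * a₂ - b₁₃) + (r ^ 2 + 1) * (r * t - t₀) +
        r * (r + 1) / 2 * (b₁₂ - t + (t₀ - a₃)) +
        r * (r - 1) / 2 * (t₀ - a₃ - (b₁₂ - t))) / r ^ 3 := by
    field_simp
    ring
  rw [key]
  have e₁ := sub_nonneg.2 h₂₃
  have e₂ := sub_nonneg.2 h₁₃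
  have e₃ := sub_nonneg.2 h
  have e₄ : 0 ≤ b₁₂ - t + (t₀ - a₃) := by linarith
  have e₅ := sub_nonneg.2 hhi
  have e₆ := sub_nonneg.2 hr
  positivity

/-- Positivity of the tripartite form `q_{(0,0,1)}` at parameter `-1/r` for nonzero
positive semidefinite matrices of rank `r`. -/
theorem q001_at_neg_inv_rank_nonneg (d₁ d₂ d₃ : ℕ) (h₁ : 1 ≤ d₁) (h₂ : 1 ≤ d₂) (h₃ : 1 ≤ d₃)
    (C : Matrix (Fin d₁ × Fin d₂ × Fin d₃) (Fin d₁ × Fin d₂ × Fin d₃) ℂ)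
    (hpsd : C.PosSemidef) (hC : C ≠ 0) :
    0 ≤ frobSq C + (1 / (C.rank : ℝ)) * (frobSq (tr1 C) + frobSq (tr2 C) - frobSq (tr3 C))
        + (1 / (C.rank : ℝ) ^ 2) * (frobSq (tr12 C) - frobSq (tr13 C) - frobSq (tr23 C))
        - (1 / (C.rank : ℝ) ^ 3) * ‖C.trace‖ ^ 2 := by
  obtain ⟨V, hV⟩ := hpsd.exists_gram
  have h23 := sum_normSq_trace_snd_le (α := Fin d₁) (β := Fin d₂ × Fin d₃)
    fun i p => V (i, p.1, p.2)
  have h13 := sum_normSq_trace_snd_le (α := Fin d₂) (β := Fin d₁ × Fin d₃)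
    fun j p => V (p.1, j, p.2)
  have h123 := sum_normSq_trace_snd_le (α := Unit) (β := Fin d₁ × Fin d₂ × Fin d₃)
    fun _ => V
  have hswap := abs_le.1 (abs_sum_normSq_sub_le (α := Fin d₁ × Fin d₂) (β := Fin d₃)
    fun p k => V (p.1, p.2, k))
  simp only [gramEntry, ← hV, Fintype.sum_prod_type, Fintype.card_fin, univ_unique,
    sum_singleton] at h23 h13 h123 hswap
  have htr : ‖C.trace‖ ^ 2 = ‖∑ i, ∑ j, ∑ k, C (i, j, k) (i, j, k)‖ ^ 2 := by
    simp [Matrix.trace, Fintype.sum_prod_type]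
  rw [htr]
  simp only [frobSq, tr1, tr2, tr3, tr12, tr13, tr23, Matrix.of_apply, Fintype.sum_prod_type]
  have hr : 1 ≤ (C.rank : ℝ) := by
    rw [Nat.one_le_cast, Nat.one_le_iff_ne_zero]
    intro h
    have : IsEmpty (Fin C.rank) := by rw [h]; infer_instance
    exact hC (Matrix.ext fun x y => by simp [hV x y])
  exact nonneg_of_trace_bounds hr h23 h13 h123 hswap.1 hswap.2
end

section
/- Let d₁, d₂ ≥ 1 and let v, w : Fin d₁ × Fin d₂ → ℂ. Set C = v wᴴ (i.e. C p q = v p · conj(w q)) and define D : Matrix (Fin d₁ × Fin d₂) (Fin d₁ × Fin d₂) ℂ by D (i,j) (i',j') = (if i = i' then 1 else 0)·(tr₁ C) j j' − (tr₂ C) i i'·(if j = j' then 1 else 0). Then for every vector x : Fin d₁ × Fin d₂ → ℂ, ‖D.mulVec x‖ ≤ ‖v‖·‖w‖·‖x‖, where ‖·‖ is the Euclidean (ℓ²) norm of a vector. (That is, the operator norm of 1_{d₁} ⊗ tr₁(v wᴴ) − tr₂(v wᴴ) ⊗ 1_{d₂} is at most ‖v‖·‖w‖.) -/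
open Finset

/-- Euclidean (ℓ²) norm of a finitely indexed complex vector. -/
noncomputable def vnorm {m : Type*} [Fintype m] (x : m → ℂ) : ℝ :=
  Real.sqrt (∑ p, ‖x p‖ ^ 2)

/-- The norm of an antisymmetrized elementary tensor. -/
lemma sum_norm_sq_wedge_le {ι : Type*} [Fintype ι] (a b : ι → ℂ) :
    ∑ p, ∑ q, ‖a p * b q - a q * b p‖ ^ 2 ≤ 2 * ((∑ p, ‖a p‖ ^ 2) * ∑ p, ‖b p‖ ^ 2) := by
  have hcross : ∑ p, ∑ q, (a p * b q * (starRingEnd ℂ) (a q * b p)).re =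
      Complex.normSq (∑ p, a p * (starRingEnd ℂ) (b p)) := by
    have h : ∑ p, ∑ q, a p * b q * (starRingEnd ℂ) (a q * b p) =
        (Complex.normSq (∑ p, a p * (starRingEnd ℂ) (b p)) : ℂ) := by
      rw [← Complex.mul_conj, map_sum, Finset.sum_mul_sum]
      refine Finset.sum_congr rfl fun p _ => Finset.sum_congr rfl fun q _ => ?_
      simp only [map_mul, Complex.conj_conj]
      ring
    simpa using congrArg Complex.re h
  have hpt : ∀ p q, ‖a p * b q - a q * b p‖ ^ 2 = ‖a p‖ ^ 2 * ‖b q‖ ^ 2 + ‖b p‖ ^ 2 * ‖a q‖ ^ 2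
      - 2 * (a p * b q * (starRingEnd ℂ) (a q * b p)).re := by
    intro p q
    simp only [← Complex.normSq_eq_norm_sq, Complex.normSq_sub, Complex.normSq_mul]
    ring
  simp only [hpt, Finset.sum_sub_distrib, Finset.sum_add_distrib, ← Finset.mul_sum,
    ← Finset.sum_mul, hcross]
  nlinarith [Complex.normSq_nonneg (∑ p, a p * (starRingEnd ℂ) (b p))]

/-- Exchanging the first indices of a pair of double indices. -/
lemma sum_swap_fst {α β M : Type*} [Fintype α] [Fintype β] [AddCommMonoid M]
    (f : α × β → α × β → M) :
    ∑ p : α × β, ∑ q : α × β, f (q.1, p.2) (p.1, q.2) = ∑ p, ∑ q, f p q := by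
  simp only [Fintype.sum_prod_type]
  rw [Finset.sum_comm]
  conv_rhs => rw [Finset.sum_comm]
  refine Finset.sum_congr rfl fun b _ => ?_
  rw [Finset.sum_comm]

/-- The action of `1 ⊗ tr₁ (v wᴴ) - tr₂ (v wᴴ) ⊗ 1` on a vector. -/
lemma mulVec_kroneckerDiff_rank_one {d₁ d₂ : ℕ} (v w x : Fin d₁ × Fin d₂ → ℂ)
    (p : Fin d₁ × Fin d₂) :
    (Matrix.of fun p q : Fin d₁ × Fin d₂ =>
      (if p.1 = q.1 then (1 : ℂ) else 0) *
          ptr1 (Matrix.of fun p q => v p * (starRingEnd ℂ) (w q)) p.2 q.2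
        - ptr2 (Matrix.of fun p q => v p * (starRingEnd ℂ) (w q)) p.1 q.1 *
          (if p.2 = q.2 then (1 : ℂ) else 0)).mulVec x p =
      ∑ q, (starRingEnd ℂ) (w q) *
        (v (q.1, p.2) * x (p.1, q.2) - v (p.1, q.2) * x (q.1, p.2)) := by
  simp only [Matrix.mulVec, dotProduct, ptr1, ptr2, Matrix.of_apply, sub_mul, mul_sub,
    Finset.sum_sub_distrib, Fintype.sum_prod_type, ite_mul, mul_ite, one_mul, zero_mul, mul_one,
    mul_zero, Finset.sum_ite_irrel, Finset.sum_const_zero, Finset.sum_ite_eq, Finset.mem_univ,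
    if_true, Finset.sum_mul]
  congr 1
  · rw [Finset.sum_comm]
    exact Finset.sum_congr rfl fun i _ => Finset.sum_congr rfl fun j _ => by ring
  · exact Finset.sum_congr rfl fun i _ => Finset.sum_congr rfl fun j _ => by ring

/-- Contracting `w` with the difference of the two partial swaps of `v ⊗ x` yields a vector of
norm at most `‖v‖ ‖w‖ ‖x‖`. -/
lemma sum_norm_sq_partialSwap_le {α β : Type*} [Fintype α] [Fintype β] (v w x : α × β → ℂ) :
    ∑ p : α × β, ‖∑ q : α × β, (starRingEnd ℂ) (w q) *
        (v (q.1, p.2) * x (p.1, q.2) - v (p.1, q.2) * x (q.1, p.2))‖ ^ 2 ≤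
      (∑ p, ‖v p‖ ^ 2) * (∑ p, ‖w p‖ ^ 2) * ∑ p, ‖x p‖ ^ 2 := by
  set B : α × β → α × β → ℂ := fun p q =>
    v (q.1, p.2) * x (p.1, q.2) - v (p.1, q.2) * x (q.1, p.2) with hB
  set y : α × β → ℂ := fun p => ∑ q, (starRingEnd ℂ) (w q) * B p q with hy
  change ∑ p, ‖y p‖ ^ 2 ≤ _
  have hBanti : ∀ p q, B q p = -B p q := fun p q => by simp only [hB]; ring
  have hBsq : ∑ p, ∑ q, ‖B p q‖ ^ 2 ≤ 2 * ((∑ p, ‖v p‖ ^ 2) * ∑ p, ‖x p‖ ^ 2) :=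
    (sum_swap_fst fun p q => ‖v p * x q - v q * x p‖ ^ 2).trans_le (sum_norm_sq_wedge_le v x)
  have hAsq := sum_norm_sq_wedge_le y w
  have hpair : ((∑ p, ‖y p‖ ^ 2 : ℝ) : ℂ) =
      ∑ p, ∑ q, (starRingEnd ℂ) (y p) * (starRingEnd ℂ) (w q) * B p q := by
    push_cast
    refine Finset.sum_congr rfl fun p _ => ?_
    rw [← Complex.conj_mul']
    conv_lhs => rw [hy]
    simp only [Finset.mul_sum, mul_assoc, hy]
  have hanti : (2 : ℂ) * ((∑ p, ‖y p‖ ^ 2 : ℝ) : ℂ) =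
      ∑ p, ∑ q, (starRingEnd ℂ) (y p * w q - y q * w p) * B p q := by
    rw [two_mul]
    nth_rewrite 2 [hpair]
    rw [Finset.sum_comm, hpair, ← Finset.sum_add_distrib]
    refine Finset.sum_congr rfl fun p _ => ?_
    rw [← Finset.sum_add_distrib]
    refine Finset.sum_congr rfl fun q _ => ?_
    rw [hBanti p q]
    simp only [map_sub, map_mul]
    ring
  have hnorm : 2 * ∑ p, ‖y p‖ ^ 2 ≤ ∑ p, ∑ q, ‖y p * w q - y q * w p‖ * ‖B p q‖ := by
    have h0 : 0 ≤ ∑ p, ‖y p‖ ^ 2 := by positivity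
    calc 2 * ∑ p, ‖y p‖ ^ 2 = ‖(2 : ℂ) * ((∑ p, ‖y p‖ ^ 2 : ℝ) : ℂ)‖ := by
          rw [norm_mul, Complex.norm_real, Real.norm_of_nonneg h0, Complex.norm_ofNat]
      _ ≤ ∑ p, ∑ q, ‖y p * w q - y q * w p‖ * ‖B p q‖ := by
          rw [hanti]
          refine (norm_sum_le _ _).trans (Finset.sum_le_sum fun p _ => ?_)
          refine (norm_sum_le _ _).trans (Finset.sum_le_sum fun q _ => ?_)
          rw [norm_mul, Complex.norm_conj]
  have hcs : (∑ p, ∑ q, ‖y p * w q - y q * w p‖ * ‖B p q‖) ^ 2 ≤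
      (∑ p, ∑ q, ‖y p * w q - y q * w p‖ ^ 2) * ∑ p, ∑ q, ‖B p q‖ ^ 2 := by
    simp only [← Fintype.sum_prod_type']
    exact Finset.sum_mul_sq_le_sq_mul_sq _ _ _
  have hy0 : 0 ≤ ∑ p, ‖y p‖ ^ 2 := by positivity
  have hv0 : 0 ≤ ∑ p, ‖v p‖ ^ 2 := by positivity
  have hw0 : 0 ≤ ∑ p, ‖w p‖ ^ 2 := by positivity
  have hx0 : 0 ≤ ∑ p, ‖x p‖ ^ 2 := by positivity
  clear_value y B
  have hfin : (2 * ∑ p, ‖y p‖ ^ 2) ^ 2 ≤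
      (2 * ((∑ p, ‖y p‖ ^ 2) * ∑ p, ‖w p‖ ^ 2)) *
        (2 * ((∑ p, ‖v p‖ ^ 2) * ∑ p, ‖x p‖ ^ 2)) := by
    refine (pow_le_pow_left₀ (by positivity) hnorm 2).trans (hcs.trans ?_)
    gcongr
  rcases hy0.eq_or_lt with h | h
  · rw [← h]
    positivity
  · refine le_of_mul_le_mul_left ?_ h
    linarith

/-- For the rank-one matrix `C = v wᴴ`, the operator norm of
`1_{d₁} ⊗ tr₁ C − tr₂ C ⊗ 1_{d₂}` is at most `‖v‖ ‖w‖`. -/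
theorem mulVec_kroneckerDiff_rank_one_le (d₁ d₂ : ℕ) (h₁ : 1 ≤ d₁) (h₂ : 1 ≤ d₂)
    (v w : Fin d₁ × Fin d₂ → ℂ)
    (C D : Matrix (Fin d₁ × Fin d₂) (Fin d₁ × Fin d₂) ℂ)
    (hC : C = Matrix.of fun p q => v p * (starRingEnd ℂ) (w q))
    (hD : D = Matrix.of fun p q =>
      (if p.1 = q.1 then (1 : ℂ) else 0) * ptr1 C p.2 q.2
        - ptr2 C p.1 q.1 * (if p.2 = q.2 then (1 : ℂ) else 0))
    (x : Fin d₁ × Fin d₂ → ℂ) :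
    vnorm (D.mulVec x) ≤ vnorm v * vnorm w * vnorm x := by
  have hN := sum_norm_sq_partialSwap_le v w x
  have hDx : D.mulVec x = fun p => ∑ q, (starRingEnd ℂ) (w q) *
      (v (q.1, p.2) * x (p.1, q.2) - v (p.1, q.2) * x (q.1, p.2)) := by
    funext p
    rw [hD, hC, mulVec_kroneckerDiff_rank_one]
  rw [hDx]
  unfold vnorm
  rw [← Real.sqrt_mul (by positivity), ← Real.sqrt_mul (by positivity)]
  exact Real.sqrt_le_sqrt hN
end

section
/- Let n be a positive even natural number and let m be a natural number with m < n. Then the real number S = ∑_{k=m}^{n-1} (−1)^k · 2^(m−k) · (n choose k) · (k choose m) satisfies: S = 0 if m is even (in particular if m = 0), and S < 0 if m is odd. In fact S = (n choose m) · (1/2)^(n−m) · ((−1)^m − (−1)^n). -/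
open Finset

/-- The alternating binomial sum `S = ∑_{k=m}^{n-1} (-1)^k (1/2)^{k-m} (n choose k) (k choose m)`. -/
noncomputable def altSum (n m : ℕ) : ℝ :=
  ∑ k ∈ Finset.Icc m (n - 1),
    (-1 : ℝ) ^ k * (1 / 2 : ℝ) ^ (k - m) * (n.choose k : ℝ) * (k.choose m : ℝ)

/-- Including the term `k = n`, the alternating sum is evaluated by the binomial theorem. -/
theorem sum_range_neg_one_pow_mul_choose_mul_choose (m d : ℕ) :
    ∑ j ∈ Finset.range (d + 1), (-1 : ℝ) ^ (m + j) * (1 / 2 : ℝ) ^ j *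
        ((m + d).choose (m + j) : ℝ) * ((m + j).choose m : ℝ)
      = ((m + d).choose m : ℝ) * (1 / 2 : ℝ) ^ d * (-1 : ℝ) ^ m := by
  have binomial := add_pow (-(1 / 2) : ℝ) 1 d
  rw [show (-(1 / 2) : ℝ) + 1 = 1 / 2 by norm_num] at binomial
  rw [binomial, Finset.mul_sum, Finset.sum_mul]
  refine Finset.sum_congr rfl fun j hj => ?_
  have choose_mul : ((m + d).choose (m + j) : ℝ) * ((m + j).choose m : ℝ)
      = ((m + d).choose m : ℝ) * (d.choose j : ℝ) := by
    have h := Nat.choose_mul (n := m + d) (k := m + j) (s := m) (Nat.le_add_right m j)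
    simp only [Nat.add_sub_cancel_left] at h
    exact_mod_cast h
  rw [mul_assoc, choose_mul, neg_pow (1 / 2 : ℝ) j, pow_add, one_pow]
  ring

theorem altSum_eq (n m : ℕ) (hm : m < n) :
    altSum n m
      = (n.choose m : ℝ) * (1 / 2 : ℝ) ^ (n - m) * ((-1 : ℝ) ^ m - (-1 : ℝ) ^ n) := by
  obtain ⟨d, rfl⟩ := Nat.exists_eq_add_of_le hm.le
  have total := sum_range_neg_one_pow_mul_choose_mul_choose m d
  rw [Finset.sum_range_succ, Nat.choose_self] at total
  have index_eq : Finset.Icc m (m + d - 1) = Finset.Ico m (m + d) := by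
    ext k
    simp only [Finset.mem_Icc, Finset.mem_Ico]
    omega
  rw [altSum, index_eq, Finset.sum_Ico_eq_sum_range]
  simp only [Nat.add_sub_cancel_left]
  push_cast at total
  linear_combination total

/-- For `n` even positive and `m < n`: the sum `S` vanishes when `m` is even, is negative
when `m` is odd, and in fact `S = (n choose m) (1/2)^{n-m} ((-1)^m - (-1)^n)`. -/
theorem altSum_eval (n m : ℕ) (hn : 0 < n) (hne : Even n) (hm : m < n) :
    ((Even m → altSum n m = 0) ∧ (Odd m → altSum n m < 0)) ∧
      altSum n m
        = (n.choose m : ℝ) * (1 / 2 : ℝ) ^ (n - m) * ((-1 : ℝ) ^ m - (-1 : ℝ) ^ n) := by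
  have eval := altSum_eq n m hm
  refine ⟨⟨fun h => ?_, fun h => ?_⟩, eval⟩
  · rw [eval, h.neg_one_pow, hne.neg_one_pow, sub_self, mul_zero]
  · rw [eval, h.neg_one_pow, hne.neg_one_pow]
    have choose_pos : (0 : ℝ) < n.choose m := by exact_mod_cast Nat.choose_pos hm.le
    exact mul_neg_of_pos_of_neg (by positivity) (by norm_num)
end
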